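/- arXiv:1805.10894 — 2 statements merged into one kernel-verified Lean document; each statement's English description precedes it below -/
import Mathlib

section
/- Let A be the Lie algebra over ℤ with generators e_0, e_1, e_2, e_3, generators y_{i,1}, y_{i,2} for i ∈ {0,1,2,3}, and generators y_{ij,1}, y_{ij,2}, y_{ij,3} for (i,j) ∈ {(0,1), (0,2), (1,3), (2,3)}; write y_i := ⁅y_{i,1}, y_{i,2}⁆ and y_{ij} := ⁅⁅y_{ij,1}, y_{ij,2}⁆, y_{ij,3}⁆; the relations are 3^{2i}·e_i = y_i for i ∈ {0,1,2,3} and 3^{12−i}·e_j + 3^{12−j}·e_i = 3^{12−2i−2j}·y_{ij} for (i,j) ∈ {(0,1), (0,2), (1,3), (2,3)} (i.e. A is the quotient of the free Lie ℤ-algebra on all listed generators by the Lie ideal generated by these relation elements). Then the element ω := 3⁹·⁅⁅e_2, e_1⁆, e_0⁆ belongs to δ_7(A), ω does not belong to γ_7(A), and 3·ω belongs to γ_7(A). -/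
/-- The augmentation ideal of the universal enveloping algebra `U(A)` of a Lie ring `A`:
the two-sided ideal generated by the image of `A`, viewed as a `ℤ`-submodule. -/
noncomputable def augIdealLie (A : Type*) [LieRing A] [LieAlgebra ℤ A] :
    Submodule ℤ (UniversalEnvelopingAlgebra ℤ A) :=
  Submodule.span ℤ
    {x | ∃ (l r : UniversalEnvelopingAlgebra ℤ A) (m : A),
      x = l * (UniversalEnvelopingAlgebra.ι ℤ m) * r}

/-- The `n`-th dimension subring `δ_n(A) = {a ∈ A : ι(a) ∈ ϖ^n}`. -/
noncomputable def dimensionSubring (A : Type*) [LieRing A] [LieAlgebra ℤ A] (n : ℕ) : Set A :=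
  {a : A | (UniversalEnvelopingAlgebra.ι ℤ a) ∈ (augIdealLie A) ^ n}

/-- `γ_n(A)`, the `n`-th term of the lower central series of Lie ideals, with `γ_1(A) = A`. -/
def gammaLie (A : Type*) [LieRing A] [LieAlgebra ℤ A] (n : ℕ) : LieSubmodule ℤ A A :=
  LieModule.lowerCentralSeries ℤ A A (n - 1)

/-- The four index pairs `(0,1), (0,2), (1,3), (2,3)`. -/
def pairIdx : Fin 4 → Fin 4 × Fin 4 := ![(0, 1), (0, 2), (1, 3), (2, 3)]

/-- The generating set: `e_0, …, e_3`; `y_{i,1}, y_{i,2}` for `i ∈ Fin 4`; and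
`y_{ij,1}, y_{ij,2}, y_{ij,3}` for the four pairs `(i,j)`. -/
abbrev TGen : Type := Fin 4 ⊕ (Fin 4 × Fin 2) ⊕ (Fin 4 × Fin 3)

/-- The free generators `e_i`. -/
noncomputable def eF (i : Fin 4) : FreeLieAlgebra ℤ TGen :=
  FreeLieAlgebra.of ℤ (Sum.inl i)

/-- `y_i := ⁅y_{i,1}, y_{i,2}⁆`. -/
noncomputable def yF (i : Fin 4) : FreeLieAlgebra ℤ TGen :=
  ⁅FreeLieAlgebra.of ℤ ((Sum.inr (Sum.inl (i, 0)) : TGen)),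
   FreeLieAlgebra.of ℤ ((Sum.inr (Sum.inl (i, 1)) : TGen))⁆

/-- `y_{ij} := ⁅⁅y_{ij,1}, y_{ij,2}⁆, y_{ij,3}⁆` for the `k`-th pair `(i,j)`. -/
noncomputable def yyF (k : Fin 4) : FreeLieAlgebra ℤ TGen :=
  ⁅⁅FreeLieAlgebra.of ℤ ((Sum.inr (Sum.inr (k, 0)) : TGen)),
    FreeLieAlgebra.of ℤ ((Sum.inr (Sum.inr (k, 1)) : TGen))⁆,
   FreeLieAlgebra.of ℤ ((Sum.inr (Sum.inr (k, 2)) : TGen))⁆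

/-- The relation elements `3^{2i}·e_i - y_i` and
`3^{12-i}·e_j + 3^{12-j}·e_i - 3^{12-2i-2j}·y_{ij}`. -/
noncomputable def tRels : Set (FreeLieAlgebra ℤ TGen) :=
  {v | ∃ i : Fin 4, v = (3 ^ (2 * (i : ℕ)) : ℤ) • eF i - yF i} ∪
  {v | ∃ k : Fin 4, v =
    (3 ^ (12 - ((pairIdx k).1 : ℕ)) : ℤ) • eF (pairIdx k).2
      + (3 ^ (12 - ((pairIdx k).2 : ℕ)) : ℤ) • eF (pairIdx k).1
      - (3 ^ (12 - 2 * ((pairIdx k).1 : ℕ) - 2 * ((pairIdx k).2 : ℕ)) : ℤ) • yyF k}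

/-- The Lie algebra `A` presented by the above generators and relations. -/
abbrev TLie : Type :=
  FreeLieAlgebra ℤ TGen ⧸ LieSubmodule.lieSpan ℤ (FreeLieAlgebra ℤ TGen) tRels

/-- The images `e_i` of the generators in `A`. -/
noncomputable def eT (i : Fin 4) : TLie :=
  LieSubmodule.Quotient.mk' (LieSubmodule.lieSpan ℤ (FreeLieAlgebra ℤ TGen) tRels) (eF i)


theorem cyc_aux {R A G : Type*} [CommRing R] [AddCommGroup A] [Module R A]
    [AddCommGroup G] [Module R G] (M : A → A → A → G)
    (ha1 : ∀ x x' y z, M (x + x') y z = M x y z + M x' y z)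
    (ha2 : ∀ x y y' z, M x (y + y') z = M x y z + M x y' z)
    (ha3 : ∀ x y z z', M x y (z + z') = M x y z + M x y z')
    (hs1 : ∀ (n : R) x y z, M (n • x) y z = n • M x y z)
    (hs2 : ∀ (n : R) x y z, M x (n • y) z = n • M x y z)
    (hs3 : ∀ (n : R) x y z, M x y (n • z) = n • M x y z)
    (S : Submodule R G) (e0 e1 e2 e3 y0 y1 y2 y3 y01 y02 y13 y23 : A)
    (h0 : e0 = y0) (h1 : (3 ^ 2 : R) • e1 = y1) (h2 : (3 ^ 4 : R) • e2 = y2)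
    (h3 : (3 ^ 6 : R) • e3 = y3)
    (h01 : (3 ^ 12 : R) • e1 + (3 ^ 11 : R) • e0 = (3 ^ 10 : R) • y01)
    (h02 : (3 ^ 12 : R) • e2 + (3 ^ 10 : R) • e0 = (3 ^ 8 : R) • y02)
    (h13 : (3 ^ 11 : R) • e3 + (3 ^ 9 : R) • e1 = (3 ^ 4 : R) • y13)
    (h23 : (3 ^ 10 : R) • e3 + (3 ^ 9 : R) • e2 = (3 ^ 2 : R) • y23)
    (k1 : M y2 y13 y0 ∈ S) (k2 : M y2 y3 y01 ∈ S) (k3 : M y02 y3 y1 ∈ S)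
    (k4 : M y0 y23 y1 ∈ S) :
    (3 ^ 9 : R) • M e2 e1 e0 - (3 ^ 9 : R) • M e0 e2 e1 ∈ S := by
  subst h0 h1 h2 h3
  have a1 : M e2 ((3 ^ 11 : R) • e3 + (3 ^ 9 : R) • e1) e0 = M e2 ((3 ^ 4 : R) • y13) e0 := by
    rw [h13]
  have a2 : M e2 e3 ((3 ^ 12 : R) • e1 + (3 ^ 11 : R) • e0) = M e2 e3 ((3 ^ 10 : R) • y01) := by
    rw [h01]
  have a3 : M ((3 ^ 12 : R) • e2 + (3 ^ 10 : R) • e0) e3 e1 = M ((3 ^ 8 : R) • y02) e3 e1 := by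
    rw [h02]
  have a4 : M e0 ((3 ^ 10 : R) • e3 + (3 ^ 9 : R) • e2) e1 = M e0 ((3 ^ 2 : R) • y23) e1 := by
    rw [h23]
  simp only [ha1, ha2, ha3, hs1, hs2, hs3] at a1 a2 a3 a4 k1 k2 k3 k4
  have : (3 ^ 9 : R) • M e2 e1 e0 - (3 ^ 9 : R) • M e0 e2 e1 =
     (3 ^ 4 : R) • M e2 y13 e0 - (3 ^ 10 : R) • M e2 e3 y01 + (3 ^ 8 : R) • M y02 e3 e1
      - (3 ^ 2 : R) • M e0 y23 e1 := by
    rw [← a1, ← a2, ← a3, ← a4]; abel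
  rw [this]
  refine S.sub_mem (S.add_mem (S.sub_mem k1 ?_) ?_) k4
  · convert k2 using 1; rw [smul_smul]; norm_num
  · convert k3 using 1; rw [smul_smul]; norm_num


/-- The data of elements satisfying the defining relations. -/
structure RelData (R L : Type*) [CommRing R] [LieRing L] [LieAlgebra R L] where
  e : Fin 4 → L
  y : Fin 4 → L
  yy : Fin 4 → L
  u : Fin 4 × Fin 2 → L
  t : Fin 4 × Fin 3 → L
  hy : ∀ i, y i = ⁅u (i, 0), u (i, 1)⁆
  hyy : ∀ i, yy i = ⁅⁅t (i, 0), t (i, 1)⁆, t (i, 2)⁆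
  h0 : e 0 = y 0
  h1 : (3 ^ 2 : R) • e 1 = y 1
  h2 : (3 ^ 4 : R) • e 2 = y 2
  h3 : (3 ^ 6 : R) • e 3 = y 3
  h01 : (3 ^ 12 : R) • e 1 + (3 ^ 11 : R) • e 0 = (3 ^ 10 : R) • yy 0
  h02 : (3 ^ 12 : R) • e 2 + (3 ^ 10 : R) • e 0 = (3 ^ 8 : R) • yy 1
  h13 : (3 ^ 11 : R) • e 3 + (3 ^ 9 : R) • e 1 = (3 ^ 4 : R) • yy 2
  h23 : (3 ^ 10 : R) • e 3 + (3 ^ 9 : R) • e 2 = (3 ^ 2 : R) • yy 3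

section generic

variable {R L : Type*} [CommRing R] [LieRing L] [LieAlgebra R L]

variable (R L) in
/-- The augmentation ideal over a general ground ring. -/
noncomputable def augR : Submodule R (UniversalEnvelopingAlgebra R L) :=
  Submodule.span R
    {x | ∃ (l r : UniversalEnvelopingAlgebra R L) (m : L),
      x = l * (UniversalEnvelopingAlgebra.ι R m) * r}

theorem cyc (d : RelData R L) {G : Type*} [AddCommGroup G] [Module R G] (M : L → L → L → G)
    (ha1 : ∀ x x' y z, M (x + x') y z = M x y z + M x' y z)
    (ha2 : ∀ x y y' z, M x (y + y') z = M x y z + M x y' z)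
    (ha3 : ∀ x y z z', M x y (z + z') = M x y z + M x y z')
    (hs1 : ∀ (n : R) x y z, M (n • x) y z = n • M x y z)
    (hs2 : ∀ (n : R) x y z, M x (n • y) z = n • M x y z)
    (hs3 : ∀ (n : R) x y z, M x y (n • z) = n • M x y z)
    (S : Submodule R G)
    (h1 : ∀ i k j, M (d.y i) (d.yy k) (d.y j) ∈ S)
    (h2 : ∀ i k j, M (d.y i) (d.y j) (d.yy k) ∈ S)
    (h3 : ∀ i k j, M (d.yy k) (d.y i) (d.y j) ∈ S) :
    (3 ^ 9 : R) • M (d.e 2) (d.e 1) (d.e 0) - (3 ^ 9 : R) • M (d.e 0) (d.e 2) (d.e 1) ∈ S :=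
  cyc_aux M ha1 ha2 ha3 hs1 hs2 hs3 S (d.e 0) (d.e 1) (d.e 2) (d.e 3) _ _ _ _ _ _ _ _
    d.h0 d.h1 d.h2 d.h3 d.h01 d.h02 d.h13 d.h23 (h1 _ _ _) (h2 _ _ _) (h3 _ _ _) (h1 _ _ _)

/-! ### The dimension subring part -/

local notation "UU" => UniversalEnvelopingAlgebra R L
local notation "uι" => UniversalEnvelopingAlgebra.ι R (L := L)

theorem iota_lie (x y : L) : uι ⁅x, y⁆ = uι x * uι y - uι y * uι x :=
  letI : LieRing UU := LieRing.ofAssociativeRing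
  letI : LieAlgebra R UU := LieAlgebra.ofAssociativeAlgebra
  (UniversalEnvelopingAlgebra.ι R (L := L)).map_lie' (x := x) (y := y)

theorem iota_mem (x : L) : uι x ∈ augR R L ^ 1 := by
  rw [pow_one]
  exact Submodule.subset_span ⟨1, 1, x, by simp⟩

theorem iota_lie_mem {m n : ℕ} {x y : L} (hx : uι x ∈ augR R L ^ m)
    (hy : uι y ∈ augR R L ^ n) : uι ⁅x, y⁆ ∈ augR R L ^ (m + n) := by
  rw [iota_lie]
  refine sub_mem ?_ ?_
  · rw [pow_add]; exact Submodule.mul_mem_mul hx hy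
  · rw [add_comm, pow_add]; exact Submodule.mul_mem_mul hy hx

theorem iota_y (d : RelData R L) (i : Fin 4) : uι (d.y i) ∈ augR R L ^ 2 := by
  rw [d.hy]
  exact iota_lie_mem (iota_mem _) (iota_mem _)

theorem iota_yy (d : RelData R L) (i : Fin 4) : uι (d.yy i) ∈ augR R L ^ 3 := by
  rw [d.hyy]
  exact iota_lie_mem (iota_lie_mem (iota_mem _) (iota_mem _)) (iota_mem _)

theorem mul3_mem {a b c : ℕ} {x y z : UU} (hx : x ∈ augR R L ^ a)
    (hy : y ∈ augR R L ^ b) (hz : z ∈ augR R L ^ c) (h : a + b + c = 7) :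
    x * y * z ∈ (augR R L ^ 7) := by
  rw [← h, pow_add, pow_add]
  exact Submodule.mul_mem_mul (Submodule.mul_mem_mul hx hy) hz

theorem part_one (d : RelData R L) : uι ((3 ^ 9 : R) • ⁅⁅d.e 2, d.e 1⁆, d.e 0⁆) ∈ augR R L ^ 7 := by
  have c1 := cyc d (fun x y z => uι x * uι y * uι z)
    (by intros; simp [add_mul]) (by intros; simp [add_mul, mul_add])
    (by intros; simp [mul_add]) (by intros; simp) (by intros; simp) (by intros; simp)
    (augR R L ^ 7)
    (fun i k j => mul3_mem (iota_y d _) (iota_yy d _) (iota_y d _) rfl)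
    (fun i k j => mul3_mem (iota_y d _) (iota_y d _) (iota_yy d _) rfl)
    (fun i k j => mul3_mem (iota_yy d _) (iota_y d _) (iota_y d _) rfl)
  have c2 := cyc d (fun x y z => uι z * uι y * uι x)
    (by intros; simp [mul_add]) (by intros; simp [add_mul, mul_add])
    (by intros; simp [add_mul]) (by intros; simp) (by intros; simp) (by intros; simp)
    (augR R L ^ 7)
    (fun i k j => mul3_mem (iota_y d _) (iota_yy d _) (iota_y d _) rfl)
    (fun i k j => mul3_mem (iota_yy d _) (iota_y d _) (iota_y d _) rfl)
    (fun i k j => mul3_mem (iota_y d _) (iota_y d _) (iota_yy d _) rfl)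
  have c3 := add_mem c1 c2
  have : uι ((3 ^ 9 : R) • ⁅⁅d.e 2, d.e 1⁆, d.e 0⁆) =
      ((3 ^ 9 : R) • (uι (d.e 2) * uι (d.e 1) * uι (d.e 0)) -
        (3 ^ 9 : R) • (uι (d.e 0) * uι (d.e 2) * uι (d.e 1))) +
      ((3 ^ 9 : R) • (uι (d.e 0) * uι (d.e 1) * uι (d.e 2)) -
        (3 ^ 9 : R) • (uι (d.e 1) * uι (d.e 2) * uι (d.e 0))) := by
    rw [map_smul, iota_lie, iota_lie]
    simp only [mul_sub, sub_mul, smul_sub, mul_assoc]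
    abel
  rw [this]
  exact c3

/-! ### The torsion part -/

theorem lcs_lie {k : ℕ} (x : L) {w : L}
    (hw : w ∈ LieModule.lowerCentralSeries R L L k) :
    ⁅x, w⁆ ∈ LieModule.lowerCentralSeries R L L (k + 1) := by
  rw [LieModule.lowerCentralSeries_succ]
  exact LieSubmodule.lie_mem_lie (LieSubmodule.mem_top x) hw

theorem lcs_lie2 {k : ℕ} (x y : L) {w : L}
    (hw : w ∈ LieModule.lowerCentralSeries R L L k) :
    ⁅⁅x, y⁆, w⁆ ∈ LieModule.lowerCentralSeries R L L (k + 2) := by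
  rw [lie_lie]
  exact sub_mem (lcs_lie x (lcs_lie y hw)) (lcs_lie y (lcs_lie x hw))

theorem lcs_lie3 {k : ℕ} (x y z : L) {w : L}
    (hw : w ∈ LieModule.lowerCentralSeries R L L k) :
    ⁅⁅⁅x, y⁆, z⁆, w⁆ ∈ LieModule.lowerCentralSeries R L L (k + 3) := by
  rw [lie_lie]
  exact sub_mem (lcs_lie2 x y (lcs_lie z hw)) (lcs_lie z (lcs_lie2 x y hw))

theorem lcs_y {k : ℕ} (d : RelData R L) (i : Fin 4) {w : L}
    (hw : w ∈ LieModule.lowerCentralSeries R L L k) :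
    ⁅d.y i, w⁆ ∈ LieModule.lowerCentralSeries R L L (k + 2) := by
  rw [d.hy]; exact lcs_lie2 _ _ hw

theorem lcs_yy {k : ℕ} (d : RelData R L) (i : Fin 4) {w : L}
    (hw : w ∈ LieModule.lowerCentralSeries R L L k) :
    ⁅d.yy i, w⁆ ∈ LieModule.lowerCentralSeries R L L (k + 3) := by
  rw [d.hyy]; exact lcs_lie3 _ _ _ hw

theorem y_lcs (d : RelData R L) (i : Fin 4) : d.y i ∈ LieModule.lowerCentralSeries R L L 1 := by
  rw [d.hy]; exact lcs_lie (k := 0) _ (by simp)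

theorem yy_lcs (d : RelData R L) (i : Fin 4) : d.yy i ∈ LieModule.lowerCentralSeries R L L 2 := by
  rw [d.hyy]; exact lcs_lie2 (k := 0) _ _ (by simp)

theorem part_three (d : RelData R L) :
    (3 : R) • ((3 ^ 9 : R) • ⁅⁅d.e 2, d.e 1⁆, d.e 0⁆) ∈ LieModule.lowerCentralSeries R L L 6 := by
  let S : Submodule R L :=
    (LieModule.lowerCentralSeries R L L 6).toSubmodule
  have c1 := cyc d (fun x y z => ⁅z, ⁅x, y⁆⁆)
    (by intros; simp) (by intros; simp) (by intros; simp)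
    (by intros; simp) (by intros; simp) (by intros; simp) S
    (fun i k j => lcs_y (k := 4) d _ (lcs_y (k := 2) d _ (yy_lcs d _)))
    (fun i k j => lcs_yy (k := 3) d _ (lcs_y (k := 1) d _ (y_lcs d _)))
    (fun i k j => lcs_y (k := 4) d _ (lcs_yy (k := 1) d _ (y_lcs d _)))
  have c2 := cyc d (fun x y z => ⁅x, ⁅y, z⁆⁆)
    (by intros; simp) (by intros; simp) (by intros; simp)
    (by intros; simp) (by intros; simp) (by intros; simp) S
    (fun i k j => lcs_y (k := 4) d _ (lcs_yy (k := 1) d _ (y_lcs d _)))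
    (fun i k j => lcs_y (k := 4) d _ (lcs_y (k := 2) d _ (yy_lcs d _)))
    (fun i k j => lcs_yy (k := 3) d _ (lcs_y (k := 1) d _ (y_lcs d _)))
  -- [0,[2,1]] ≡ [1,[0,2]] and [2,[1,0]] ≡ [0,[2,1]]
  have c3 := sub_mem c2 c1
  have j := lie_jacobi (d.e 0) (d.e 2) (d.e 1)
  have : (3 : R) • ((3 ^ 9 : R) • ⁅⁅d.e 2, d.e 1⁆, d.e 0⁆) =
      ((3 ^ 9 : R) • ⁅d.e 2, ⁅d.e 1, d.e 0⁆⁆ - (3 ^ 9 : R) • ⁅d.e 0, ⁅d.e 2, d.e 1⁆⁆) -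
      ((3 ^ 9 : R) • ⁅d.e 0, ⁅d.e 2, d.e 1⁆⁆ - (3 ^ 9 : R) • ⁅d.e 1, ⁅d.e 0, d.e 2⁆⁆)
      - (3 ^ 9 : R) • (⁅d.e 0, ⁅d.e 2, d.e 1⁆⁆ + ⁅d.e 2, ⁅d.e 1, d.e 0⁆⁆ + ⁅d.e 1, ⁅d.e 0, d.e 2⁆⁆) := by
    rw [← lie_skew ⁅d.e 2, d.e 1⁆ (d.e 0)]
    module
  rw [this, j, smul_zero, sub_zero]
  exact c3

end generic

noncomputable def tmk : FreeLieAlgebra ℤ TGen →ₗ⁅ℤ⁆ TLie :=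
  { (LieSubmodule.Quotient.mk' (LieSubmodule.lieSpan ℤ (FreeLieAlgebra ℤ TGen) tRels)).toLinearMap
      with map_lie' := by intro x y; rfl }

theorem tmk_eF (i : Fin 4) : tmk (eF i) = eT i := rfl

theorem tmk_rel {v : FreeLieAlgebra ℤ TGen} (h : v ∈ tRels) : tmk v = 0 :=
  (LieSubmodule.Quotient.mk_eq_zero').2 (LieSubmodule.subset_lieSpan h)

theorem tmk_surj : Function.Surjective tmk := LieSubmodule.Quotient.surjective_mk' _

theorem tmk_eq_zero {v : FreeLieAlgebra ℤ TGen} (h : tmk v = 0) :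
    v ∈ LieSubmodule.lieSpan ℤ (FreeLieAlgebra ℤ TGen) tRels :=
  (LieSubmodule.Quotient.mk_eq_zero').1 h

theorem rel1 (i : Fin 4) : (3 ^ (2 * (i : ℕ)) : ℤ) • eT i = tmk (yF i) := by
  have := tmk_rel (Or.inl ⟨i, rfl⟩)
  rw [map_sub, map_smul, tmk_eF, sub_eq_zero] at this
  exact this

theorem rel2 (k : Fin 4) : (3 ^ (12 - ((pairIdx k).1 : ℕ)) : ℤ) • eT (pairIdx k).2
      + (3 ^ (12 - ((pairIdx k).2 : ℕ)) : ℤ) • eT (pairIdx k).1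
      = (3 ^ (12 - 2 * ((pairIdx k).1 : ℕ) - 2 * ((pairIdx k).2 : ℕ)) : ℤ) • tmk (yyF k) := by
  have := tmk_rel (Or.inr ⟨k, rfl⟩)
  rw [map_sub, map_add, map_smul, map_smul, map_smul, tmk_eF, tmk_eF, sub_eq_zero] at this
  exact this


noncomputable def tData : RelData ℤ TLie where
  e := eT
  y i := tmk (yF i)
  yy i := tmk (yyF i)
  u p := tmk (FreeLieAlgebra.of ℤ (Sum.inr (Sum.inl p)))
  t p := tmk (FreeLieAlgebra.of ℤ (Sum.inr (Sum.inr p)))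
  hy i := LieHom.map_lie tmk _ _
  hyy i := (LieHom.map_lie tmk _ _).trans (congrArg (fun z => ⁅z, _⁆) (LieHom.map_lie tmk _ _))
  h0 := by have := rel1 0; rwa [show (3 ^ (2 * ((0 : Fin 4) : ℕ)) : ℤ) = 1 from rfl, one_smul] at this
  h1 := rel1 1
  h2 := rel1 2
  h3 := rel1 3
  h01 := rel2 0
  h02 := rel2 1
  h13 := rel2 2
  h23 := rel2 3

theorem t_one : ((3 ^ 9 : ℤ) • ⁅⁅eT 2, eT 1⁆, eT 0⁆) ∈ dimensionSubring TLie 7 :=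
  part_one tData

theorem t_three : (3 : ℤ) • ((3 ^ 9 : ℤ) • ⁅⁅eT 2, eT 1⁆, eT 0⁆) ∈ gammaLie TLie 7 :=
  part_three tData

/-! ### A Lie ring attached to a trilinear form with a derivation -/

/-- Data for the auxiliary Lie ring. -/
structure ND (V W Z : Type) [AddCommGroup V] [AddCommGroup W] [AddCommGroup Z] where
  DV : V →+ V
  DW : W →+ W
  DZ : Z →+ Z
  B : V →+ V →+ W
  P : W →+ V →+ Z
  hB : ∀ v v', DW (B v v') = B (DV v) v' + B v (DV v')
  hP : ∀ w v, DZ (P w v) = P (DW w) v + P w (DV v)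
  alt : ∀ v, B v v = 0
  cyc : ∀ x y z, P (B x y) z + P (B y z) x + P (B z x) y = 0

section nn

variable {V W Z : Type} [AddCommGroup V] [AddCommGroup W] [AddCommGroup Z]

/-- The underlying type of the auxiliary Lie ring. -/
@[ext] structure NN (_ : ND V W Z) where
  d : ℤ
  v : V
  w : W
  z : Z

variable {D : ND V W Z}

namespace NN

instance : Zero (NN D) := ⟨⟨0, 0, 0, 0⟩⟩
instance : Add (NN D) := ⟨fun x y => ⟨x.d + y.d, x.v + y.v, x.w + y.w, x.z + y.z⟩⟩
instance : Neg (NN D) := ⟨fun x => ⟨-x.d, -x.v, -x.w, -x.z⟩⟩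

@[simp] theorem zero_d : (0 : NN D).d = 0 := rfl
@[simp] theorem zero_v : (0 : NN D).v = 0 := rfl
@[simp] theorem zero_w : (0 : NN D).w = 0 := rfl
@[simp] theorem zero_z : (0 : NN D).z = 0 := rfl
@[simp] theorem add_d (x y : NN D) : (x + y).d = x.d + y.d := rfl
@[simp] theorem add_v (x y : NN D) : (x + y).v = x.v + y.v := rfl
@[simp] theorem add_w (x y : NN D) : (x + y).w = x.w + y.w := rfl
@[simp] theorem add_z (x y : NN D) : (x + y).z = x.z + y.z := rfl
@[simp] theorem neg_d (x : NN D) : (-x).d = -x.d := rfl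
@[simp] theorem neg_v (x : NN D) : (-x).v = -x.v := rfl
@[simp] theorem neg_w (x : NN D) : (-x).w = -x.w := rfl
@[simp] theorem neg_z (x : NN D) : (-x).z = -x.z := rfl

instance : AddCommGroup (NN D) where
  add_assoc x y z := by ext <;> simp [add_assoc]
  zero_add x := by ext <;> simp
  add_zero x := by ext <;> simp
  add_comm x y := by ext <;> simp [add_comm]
  neg_add_cancel x := by ext <;> simp
  nsmul := nsmulRec
  zsmul := zsmulRec

instance : Bracket (NN D) (NN D) := ⟨fun x y =>
  ⟨0, x.d • D.DV y.v - y.d • D.DV x.v,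
    x.d • D.DW y.w - y.d • D.DW x.w + D.B x.v y.v,
    x.d • D.DZ y.z - y.d • D.DZ x.z + D.P x.w y.v - D.P y.w x.v⟩⟩

@[simp] theorem lie_d (x y : NN D) : ⁅x, y⁆.d = 0 := rfl
@[simp] theorem lie_v (x y : NN D) : ⁅x, y⁆.v = x.d • D.DV y.v - y.d • D.DV x.v := rfl
@[simp] theorem lie_w (x y : NN D) :
    ⁅x, y⁆.w = x.d • D.DW y.w - y.d • D.DW x.w + D.B x.v y.v := rfl
@[simp] theorem lie_z (x y : NN D) :
    ⁅x, y⁆.z = x.d • D.DZ y.z - y.d • D.DZ x.z + D.P x.w y.v - D.P y.w x.v := rfl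

theorem B_skew (x y : V) : D.B y x = - D.B x y := by
  have h := D.alt (x + y)
  simp only [map_add, AddMonoidHom.add_apply, D.alt, zero_add, add_zero] at h
  rw [eq_neg_iff_add_eq_zero]
  exact h

instance : LieRing (NN D) where
  add_lie x y z := by
    ext
    · simp
    all_goals
      simp only [add_d, add_v, add_w, add_z, lie_v, lie_w, lie_z, map_add, AddMonoidHom.add_apply,
        add_smul, smul_add]
      abel
  lie_add x y z := by
    ext
    · simp
    all_goals
      simp only [add_d, add_v, add_w, add_z, lie_v, lie_w, lie_z, map_add, AddMonoidHom.add_apply,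
        add_smul, smul_add]
      abel
  lie_self x := by ext <;> simp [D.alt]
  leibniz_lie x y z := by
    ext
    · simp
    · simp only [add_v, lie_v, lie_d, map_sub, map_zsmul]
      module
    · simp only [add_w, lie_w, lie_v, lie_d, map_sub, map_add, map_zsmul, D.hB,
        AddMonoidHom.sub_apply, AddMonoidHom.coe_smul, Pi.smul_apply]
      rw [B_skew (D := D) (D.DV x.v) y.v]
      module
    · have h := D.cyc x.v y.v z.v
      simp only [add_z, lie_z, lie_w, lie_v, lie_d, map_sub, map_add, map_zsmul, D.hP,
        AddMonoidHom.sub_apply, AddMonoidHom.add_apply, AddMonoidHom.coe_smul, Pi.smul_apply]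
      rw [B_skew (D := D) x.v z.v] at h
      simp only [map_neg, AddMonoidHom.neg_apply] at h
      have h' : D.P (D.B y.v z.v) x.v = - D.P (D.B x.v y.v) z.v + D.P (D.B x.v z.v) y.v := by
        rw [← sub_eq_zero, ← h]; abel
      rw [h']
      module

/-- Inclusion of `V`. -/
def inV : V →+ NN D := AddMonoidHom.mk' (fun v => ⟨0, v, 0, 0⟩) (by intros; ext <;> simp)

/-- Inclusion of `Z`. -/
def inZ : Z →+ NN D := AddMonoidHom.mk' (fun z => ⟨0, 0, 0, z⟩) (by intros; ext <;> simp)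

/-- The element acting as the negative of the derivation. -/
def dd : NN D := ⟨-1, 0, 0, 0⟩

theorem lie_dd (v : V) : ⁅(inV v : NN D), (dd : NN D)⁆ = inV (D.DV v) := by
  ext <;> simp [inV, dd]

theorem lie_three (a b c : V) :
    ⁅⁅(inV a : NN D), (inV b : NN D)⁆, (inV c : NN D)⁆ = inZ (D.P (D.B a b) c) := by
  ext <;> simp [inV, inZ, -lie_lie]

end NN

/-- A filtration on the data. -/
structure NFil (D : ND V W Z) where
  FV : ℕ → AddSubgroup V
  FW : ℕ → AddSubgroup W
  FZ : ℕ → AddSubgroup Z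
  aV : ∀ k, FV (k + 1) ≤ FV k
  aW : ∀ k, FW (k + 1) ≤ FW k
  aZ : ∀ k, FZ (k + 1) ≤ FZ k
  dV : ∀ k v, v ∈ FV k → D.DV v ∈ FV (k + 1)
  dW : ∀ k v, v ∈ FW k → D.DW v ∈ FW (k + 1)
  dZ : ∀ k v, v ∈ FZ k → D.DZ v ∈ FZ (k + 1)
  bB : ∀ m n v v', v ∈ FV m → v' ∈ FV n → D.B v v' ∈ FW (m + n)
  bP : ∀ m n w v, w ∈ FW m → v ∈ FV n → D.P w v ∈ FZ (m + n)

variable (Q : NFil D)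

/-- The induced filtration on the Lie ring. -/
def NFil.F (k : ℕ) : AddSubgroup (NN D) where
  carrier := {x | (2 ≤ k → x.d = 0) ∧ x.v ∈ Q.FV k ∧ x.w ∈ Q.FW k ∧ x.z ∈ Q.FZ k}
  zero_mem' := by simp
  add_mem' := by
    rintro x y ⟨a, b, c, d⟩ ⟨a', b', c', d'⟩
    exact ⟨fun h => by simp [a h, a' h], add_mem b b', add_mem c c', add_mem d d'⟩
  neg_mem' := by
    rintro x ⟨a, b, c, d⟩
    exact ⟨fun h => by simp [a h], neg_mem b, neg_mem c, neg_mem d⟩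

theorem NFil.F_anti {k : ℕ} {x : NN D} (h : x ∈ Q.F (k + 1)) (_ : 1 ≤ k) : x ∈ Q.F k :=
  ⟨fun _ => h.1 (by omega), Q.aV _ h.2.1, Q.aW _ h.2.2.1, Q.aZ _ h.2.2.2⟩

theorem NFil.lie_mem {k : ℕ} (hk : 1 ≤ k) {x y : NN D} (hx : x ∈ Q.F 1) (hy : y ∈ Q.F k) :
    ⁅x, y⁆ ∈ Q.F (k + 1) := by
  obtain ⟨-, b, c, d⟩ := hx
  obtain ⟨a', b', c', d'⟩ := hy
  have key : y.d = 0 ∨ k = 1 := by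
    by_cases h : 2 ≤ k
    · exact Or.inl (a' h)
    · right; omega
  refine ⟨fun _ => rfl, ?_, ?_, ?_⟩
  · refine sub_mem (zsmul_mem (Q.dV _ _ b') _) ?_
    rcases key with h | rfl
    · rw [h, zero_smul]; exact zero_mem _
    · exact zsmul_mem (Q.dV _ _ b) _
  · refine add_mem (sub_mem (zsmul_mem (Q.dW _ _ c') _) ?_) ?_
    · rcases key with h | rfl
      · rw [h, zero_smul]; exact zero_mem _
      · exact zsmul_mem (Q.dW _ _ c) _
    · rw [add_comm k]; exact Q.bB _ _ _ _ b b'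
  · refine sub_mem (add_mem (sub_mem (zsmul_mem (Q.dZ _ _ d') _) ?_) ?_) ?_
    · rcases key with h | rfl
      · rw [h, zero_smul]; exact zero_mem _
      · exact zsmul_mem (Q.dZ _ _ d) _
    · rw [add_comm k]; exact Q.bP _ _ _ _ c b'
    · exact Q.bP _ _ _ _ c' b

/-- The first filtration step as a Lie subalgebra. -/
def NFil.sub : LieSubalgebra ℤ (NN D) where
  carrier := Q.F 1
  zero_mem' := zero_mem _
  add_mem' := add_mem
  smul_mem' n _ h := zsmul_mem h n
  lie_mem' h h' := Q.F_anti (Q.lie_mem le_rfl h h') le_rfl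

/-- Lifting a map from generators to the free Lie algebra. -/
noncomputable def NFil.hom {X : Type} (g : X → NN D) (hg : ∀ x, g x ∈ Q.F 1) :
    FreeLieAlgebra ℤ X →ₗ⁅ℤ⁆ NN D :=
  Q.sub.incl.comp (FreeLieAlgebra.lift ℤ (fun x => (⟨g x, hg x⟩ : Q.sub)))

theorem NFil.hom_of {X : Type} (g : X → NN D) (hg : ∀ x, g x ∈ Q.F 1) (x : X) :
    Q.hom g hg (FreeLieAlgebra.of ℤ x) = g x := by
  change ((FreeLieAlgebra.lift ℤ (fun x => (⟨g x, hg x⟩ : Q.sub)))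
    (FreeLieAlgebra.of ℤ x)).1 = g x
  rw [FreeLieAlgebra.lift_of_apply]

theorem NFil.hom_mem {X : Type} (g : X → NN D) (hg : ∀ x, g x ∈ Q.F 1)
    (x : FreeLieAlgebra ℤ X) : Q.hom g hg x ∈ Q.F 1 :=
  (FreeLieAlgebra.lift ℤ (fun x => (⟨g x, hg x⟩ : Q.sub)) x).2

/-- Pulled back filtration, as Lie ideals. -/
noncomputable def NFil.pull {X : Type} (g : X → NN D) (hg : ∀ x, g x ∈ Q.F 1) (k : ℕ) :
    LieSubmodule ℤ (FreeLieAlgebra ℤ X) (FreeLieAlgebra ℤ X) where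
  carrier := {x | Q.hom g hg x ∈ Q.F (k + 1)}
  zero_mem' := by simp [zero_mem]
  add_mem' h h' := by simpa using add_mem h h'
  smul_mem' n x h := by
    have : Q.hom g hg (n • x) = n • Q.hom g hg x := map_zsmul _ _ _
    change Q.hom g hg (n • x) ∈ Q.F (k + 1)
    rw [this]; exact zsmul_mem h n
  lie_mem {x m} h := by
    change Q.hom g hg ⁅x, m⁆ ∈ Q.F (k + 1)
    rw [LieHom.map_lie]
    exact Q.F_anti (Q.lie_mem (by omega) (Q.hom_mem g hg x) h) (by omega)

end nn

theorem part_two_abs {V W Z : Type} [AddCommGroup V] [AddCommGroup W] [AddCommGroup Z]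
    {D : ND V W Z} (Q : NFil D) (g : TGen → NN D) (hg : ∀ x, g x ∈ Q.F 1)
    (hr : ∀ v ∈ tRels, Q.hom g hg v ∈ Q.F 7)
    (x : FreeLieAlgebra ℤ TGen) (hx : tmk x ∈ gammaLie TLie 7) : Q.hom g hg x ∈ Q.F 7 := by
  have key : ∀ k, ∀ a ∈ LieModule.lowerCentralSeries ℤ TLie TLie k,
      ∃ x, tmk x = a ∧ Q.hom g hg x ∈ Q.F (k + 1) := by
    intro k
    induction k with
    | zero =>
      intro a _
      obtain ⟨x, rfl⟩ := tmk_surj a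
      exact ⟨x, rfl, Q.hom_mem g hg x⟩
    | succ k ih =>
      intro a ha
      rw [LieModule.lowerCentralSeries_succ, ← LieSubmodule.mem_toSubmodule,
        LieSubmodule.lieIdeal_oper_eq_linear_span'] at ha
      induction ha using Submodule.span_induction with
      | mem a h =>
        obtain ⟨p, -, q, hq, rfl⟩ := h
        obtain ⟨p, rfl⟩ := tmk_surj p
        obtain ⟨q, rfl, hq'⟩ := ih q hq
        refine ⟨⁅p, q⁆, LieHom.map_lie _ _ _, ?_⟩
        rw [LieHom.map_lie]
        exact Q.lie_mem (by omega) (Q.hom_mem g hg p) hq'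
      | zero => exact ⟨0, map_zero _, by rw [map_zero]; exact zero_mem _⟩
      | add a b _ _ h h' =>
        obtain ⟨x, rfl, hx⟩ := h
        obtain ⟨y, rfl, hy⟩ := h'
        exact ⟨x + y, map_add _ _ _, by rw [map_add]; exact add_mem hx hy⟩
      | smul n a _ h =>
        obtain ⟨x, rfl, hx⟩ := h
        refine ⟨n • x, map_smul _ _ _, ?_⟩
        exact (Q.pull g hg (k + 1)).smul_mem n hx
  obtain ⟨x', h1, h2⟩ := key 6 _ hx
  have h3 : x - x' ∈ LieSubmodule.lieSpan ℤ (FreeLieAlgebra ℤ TGen) tRels :=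
    tmk_eq_zero (by rw [map_sub, h1, sub_self])
  have h4 : LieSubmodule.lieSpan ℤ (FreeLieAlgebra ℤ TGen) tRels ≤ Q.pull g hg 6 :=
    LieSubmodule.lieSpan_le.2 hr
  have h5 := add_mem (h4 h3) (show x' ∈ Q.pull g hg 6 from h2)
  rw [sub_add_cancel] at h5
  exact h5

/-! ### The concrete data -/

/-- Nonzero values of the trilinear form on Hall triples, row `a` indexed by `8 b + c`. -/
def hallList : List (List (ℕ × ℤ)) :=
  [[],
   [(2, 4 * 3 ^ 4), (3, -3 ^ 3)],
   [(1, -4 * 3 ^ 4), (3, -5 * 3 ^ 2), (7, 13 * 3 ^ 10), (10, -3 ^ 2), (11, -4 * 3), (14, -4 * 3 ^ 8), (15, -5 * 3 ^ 9)],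
   [(1, -5 * 3 ^ 3), (2, -4 * 3 ^ 2), (3, 5 * 3), (7, 3 ^ 9), (10, 3), (11, 4), (14, -23 * 3 ^ 7), (15, 86 * 3 ^ 8), (18, -1), (22, 86 * 3 ^ 6), (23, -3 ^ 7)],
   [],
   [(19, -4 * 3 ^ 4), (27, 49 * 3 ^ 3)],
   [(3, -5 * 3 ^ 8), (10, 10 * 3 ^ 8), (11, -50 * 3 ^ 7), (19, 4 * 3 ^ 6), (27, -4 * 3 ^ 5)],
   [(2, -13 * 3 ^ 10), (18, 80 * 3 ^ 8)]]

/-- Value on a Hall triple. -/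
def hv (a b c : ℕ) : ℤ := ((hallList.getD a []).lookup (8 * b + c)).getD 0

/-- Value for `a > b`. -/
def hw (a b c : ℕ) : ℤ := if b ≤ c then hv a b c else hv a c b - hv b c a

/-- The trilinear form on basis vectors. -/
def TT (a b c : Fin 8) : ℤ :=
  if b < a then hw a b c else if a < b then - hw b a c else 0

theorem TT_alt (a c : Fin 8) : TT a a c = 0 := by simp [TT]

theorem TT_skew (a b c : Fin 8) : TT a b c = - TT b a c := by
  unfold TT
  rcases lt_trichotomy a b with h | h | h
  · simp [h, not_lt.2 h.le]
  · subst h; simp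
  · simp [h, not_lt.2 h.le]

theorem TT_cyc : ∀ a b c : Fin 8, TT a b c + TT b c a + TT c a b = 0 := by
  decide +kernel

/-- Generators of the filtration as sparse vectors, with their levels. -/
def gensL : List (ℕ × List (ℤ × Fin 8)) :=
  [(1, [(1, 0)]), (1, [(1, 1)]), (1, [(1, 2)]), (1, [(1, 3)]),
   (2, [(1, 0)]), (2, [(3 ^ 2, 1)]), (2, [(3 ^ 4, 2)]), (2, [(3 ^ 6, 3)]),
   (3, [(1, 4)]), (3, [(1, 5)]), (3, [(1, 6)]), (3, [(1, 7)]),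
   (7, [(3 ^ 12, 1), (3 ^ 11, 0), (- 3 ^ 10, 4)]),
   (7, [(3 ^ 12, 2), (3 ^ 10, 0), (- 3 ^ 8, 5)]),
   (7, [(3 ^ 11, 3), (3 ^ 9, 1), (- 3 ^ 4, 6)]),
   (7, [(3 ^ 10, 3), (3 ^ 9, 2), (- 3 ^ 2, 7)])]

/-- The form on sparse vectors. -/
def tl (l m n : List (ℤ × Fin 8)) : ℤ :=
  (l.map fun p => (m.map fun q => (n.map fun r => p.1 * (q.1 * (r.1 * TT p.2 q.2 r.2))).sum).sum).sum

theorem tl_check : ∀ s ∈ gensL, ∀ t ∈ gensL, ∀ u ∈ gensL, 7 ≤ s.1 + t.1 + u.1 →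
    tl s.2 t.2 u.2 % (3 ^ 14 : ℕ) = 0 := by
  decide +kernel

/-- The ground ring. -/
abbrev RR : Type := ZMod (3 ^ 14)

/-- The constant vectors. -/
abbrev VV : Type := Fin 8 → RR

/-- The polynomial vectors. -/
abbrev PV : Type := Fin 8 → Polynomial RR

/-- Reduced structure constants. -/
def tc (a b c : Fin 8) : RR := (TT a b c : RR)

theorem tc_alt (a c : Fin 8) : tc a a c = 0 := by simp [tc, TT_alt]

theorem tc_skew (a b c : Fin 8) : tc a b c = - tc b a c := by
  unfold tc; rw [TT_skew]; push_cast; rfl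

theorem tc_cyc (a b c : Fin 8) : tc a b c + tc b c a + tc c a b = 0 := by
  unfold tc; exact_mod_cast congrArg (Int.cast : ℤ → RR) (TT_cyc a b c)

/-- The trilinear form. -/
def tau (u v w : VV) : RR := ∑ a, ∑ b, ∑ c, tc a b c * (u a * (v b * w c))

theorem tau_add1 (u u' v w : VV) : tau (u + u') v w = tau u v w + tau u' v w := by
  simp only [tau, Pi.add_apply, ← Finset.sum_add_distrib]
  refine Finset.sum_congr rfl fun a _ => Finset.sum_congr rfl fun b _ =>
    Finset.sum_congr rfl fun c _ => by ring

theorem tau_add2 (u v v' w : VV) : tau u (v + v') w = tau u v w + tau u v' w := by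
  simp only [tau, Pi.add_apply, ← Finset.sum_add_distrib]
  refine Finset.sum_congr rfl fun a _ => Finset.sum_congr rfl fun b _ =>
    Finset.sum_congr rfl fun c _ => by ring

theorem tau_add3 (u v w w' : VV) : tau u v (w + w') = tau u v w + tau u v w' := by
  simp only [tau, Pi.add_apply, ← Finset.sum_add_distrib]
  refine Finset.sum_congr rfl fun a _ => Finset.sum_congr rfl fun b _ =>
    Finset.sum_congr rfl fun c _ => by ring

theorem tau_smul1 (r : RR) (u v w : VV) : tau (r • u) v w = r * tau u v w := by
  simp only [tau, Pi.smul_apply, smul_eq_mul, Finset.mul_sum]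
  refine Finset.sum_congr rfl fun a _ => Finset.sum_congr rfl fun b _ =>
    Finset.sum_congr rfl fun c _ => by ring

theorem tau_smul2 (r : RR) (u v w : VV) : tau u (r • v) w = r * tau u v w := by
  simp only [tau, Pi.smul_apply, smul_eq_mul, Finset.mul_sum]
  refine Finset.sum_congr rfl fun a _ => Finset.sum_congr rfl fun b _ =>
    Finset.sum_congr rfl fun c _ => by ring

theorem tau_smul3 (r : RR) (u v w : VV) : tau u v (r • w) = r * tau u v w := by
  simp only [tau, Pi.smul_apply, smul_eq_mul, Finset.mul_sum]
  refine Finset.sum_congr rfl fun a _ => Finset.sum_congr rfl fun b _ =>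
    Finset.sum_congr rfl fun c _ => by ring

/-- Basis vectors. -/
def bas (a : Fin 8) : VV := Pi.single a 1

theorem tau_bas (a b c : Fin 8) : tau (bas a) (bas b) (bas c) = tc a b c := by
  simp [tau, bas, Pi.single_apply]

theorem tau_zero1 (v w : VV) : tau 0 v w = 0 := by simp [tau]
theorem tau_zero2 (v w : VV) : tau v 0 w = 0 := by simp [tau]
theorem tau_zero3 (v w : VV) : tau v w 0 = 0 := by simp [tau]

/-- Vector from a sparse list. -/
def vec (l : List (ℤ × Fin 8)) : VV := (l.map fun p => (p.1 : RR) • bas p.2).sum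

theorem tau_vec (l m n : List (ℤ × Fin 8)) : tau (vec l) (vec m) (vec n) = (tl l m n : RR) := by
  have h3 : ∀ (a b : Fin 8) (n : List (ℤ × Fin 8)), tau (bas a) (bas b) (vec n) =
      (((n.map fun r => r.1 * TT a b r.2).sum : ℤ) : RR) := by
    intro a b n
    induction n with
    | nil => simp [vec, tau_zero3]
    | cons r n ih =>
      have : vec (r :: n) = (r.1 : RR) • bas r.2 + vec n := by simp [vec]
      rw [this, tau_add3, tau_smul3, tau_bas, ih]
      simp [tc]
  have h2 : ∀ (a : Fin 8) (m : List (ℤ × Fin 8)), tau (bas a) (vec m) (vec n) =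
      (((m.map fun q => (n.map fun r => q.1 * (r.1 * TT a q.2 r.2)).sum).sum : ℤ) : RR) := by
    intro a m
    induction m with
    | nil => simp [vec, tau_zero2]
    | cons q m ih =>
      have : vec (q :: m) = (q.1 : RR) • bas q.2 + vec m := by simp [vec]
      rw [this, tau_add2, tau_smul2, h3, ih]
      simp [List.sum_map_mul_left]
  unfold tl
  induction l with
  | nil => simp [vec, tau_zero1]
  | cons p l ih =>
    have : vec (p :: l) = (p.1 : RR) • bas p.2 + vec l := by simp [vec]
    rw [this, tau_add1, tau_smul1, h2, ih]
    simp [List.sum_map_mul_left]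

/-- The filtration on constant vectors. -/
def Vf (n : ℕ) : Submodule RR VV :=
  Submodule.span RR {v | ∃ s ∈ gensL, n ≤ s.1 ∧ v = vec s.2}

theorem Vf_anti {m n : ℕ} (h : m ≤ n) : Vf n ≤ Vf m :=
  Submodule.span_mono (by rintro v ⟨s, hs, h1, rfl⟩; exact ⟨s, hs, h.trans h1, rfl⟩)

theorem tau_Vf {i j k : ℕ} (h : 7 ≤ i + j + k) {u v w : VV} (hu : u ∈ Vf i) (hv : v ∈ Vf j)
    (hw : w ∈ Vf k) : tau u v w = 0 := by
  induction hu using Submodule.span_induction with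
  | zero => exact tau_zero1 _ _
  | add x y _ _ hx hy => rw [tau_add1, hx, hy, add_zero]
  | smul r x _ hx => rw [tau_smul1, hx, mul_zero]
  | mem u hu =>
    induction hv using Submodule.span_induction with
    | zero => exact tau_zero2 _ _
    | add x y _ _ hx hy => rw [tau_add2, hx, hy, add_zero]
    | smul r x _ hx => rw [tau_smul2, hx, mul_zero]
    | mem v hv =>
      induction hw using Submodule.span_induction with
      | zero => exact tau_zero3 _ _
      | add x y _ _ hx hy => rw [tau_add3, hx, hy, add_zero]
      | smul r x _ hx => rw [tau_smul3, hx, mul_zero]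
      | mem w hw =>
        obtain ⟨s, hs, h1, rfl⟩ := hu
        obtain ⟨t, ht, h2, rfl⟩ := hv
        obtain ⟨u, hu, h3, rfl⟩ := hw
        rw [tau_vec, ZMod.intCast_zmod_eq_zero_iff_dvd]
        exact Int.dvd_of_emod_eq_zero (tl_check s hs t ht u hu (by omega))

open Polynomial in
/-- The bilinear map. -/
noncomputable def bet (v v' : PV) : PV := fun c => ∑ a, ∑ b, C (tc a b c) * (v a * v' b)

/-- The pairing. -/
noncomputable def pai (w v : PV) : Polynomial RR := ∑ a, w a * v a

/-- The derivation on vectors. -/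
noncomputable def derV : PV →+ PV :=
  AddMonoidHom.mk' (fun v a => Polynomial.derivative (v a)) (by intros; ext1; simp)

theorem derV_apply (v : PV) (a : Fin 8) : derV v a = Polynomial.derivative (v a) := rfl

/-- Coefficient vector. -/
noncomputable def cf (v : PV) (j : ℕ) : VV := fun a => (v a).coeff j

theorem pai_bet (x y z : PV) : pai (bet x y) z =
    ∑ a, ∑ b, ∑ c, Polynomial.C (tc a b c) * (x a * (y b * z c)) := by
  simp only [pai, bet, Finset.sum_mul]
  rw [Finset.sum_comm]
  refine Finset.sum_congr rfl fun a _ => ?_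
  rw [Finset.sum_comm]
  refine Finset.sum_congr rfl fun b _ => Finset.sum_congr rfl fun c _ => by ring

theorem sum_rot {M : Type} [AddCommMonoid M] (f : Fin 8 → Fin 8 → Fin 8 → M) :
    ∑ a, ∑ b, ∑ c, f a b c = ∑ c, ∑ a, ∑ b, f a b c :=
  calc _ = ∑ a, ∑ c, ∑ b, f a b c := Finset.sum_congr rfl fun _ _ => Finset.sum_comm
    _ = _ := Finset.sum_comm

/-- One half. -/
def half : RR := ((2391485 : ℕ) : RR)

theorem half_two : half * 2 = 1 := by
  have : ((2391485 * 2 : ℕ) : RR) = ((1 : ℕ) : RR) := by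
    rw [ZMod.natCast_eq_natCast_iff']
    norm_num
  rw [half]
  exact_mod_cast this

theorem bet_alt (v : PV) : bet v v = 0 := by
  ext1 c
  have h : bet v v c = - bet v v c := by
    conv_lhs => rw [bet, Finset.sum_comm]
    simp only [bet, ← Finset.sum_neg_distrib]
    refine Finset.sum_congr rfl fun a _ => Finset.sum_congr rfl fun b _ => ?_
    rw [tc_skew, map_neg]; ring
  have h2 : Polynomial.C half * 2 = 1 := by
    rw [← Polynomial.C_ofNat, ← Polynomial.C_mul, half_two, Polynomial.C_1]
  change bet v v c = 0
  linear_combination (Polynomial.C half) * h - bet v v c * h2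

theorem pai_cyc (x y z : PV) : pai (bet x y) z + pai (bet y z) x + pai (bet z x) y = 0 := by
  rw [pai_bet, pai_bet, pai_bet, sum_rot (fun a b c => _ * (y a * (z b * x c))),
    ← sum_rot (fun b c a => _ * (z a * (x b * y c))), ← Finset.sum_add_distrib,
    ← Finset.sum_add_distrib]
  refine Finset.sum_eq_zero fun a _ => ?_
  rw [← Finset.sum_add_distrib, ← Finset.sum_add_distrib]
  refine Finset.sum_eq_zero fun b _ => ?_
  rw [← Finset.sum_add_distrib, ← Finset.sum_add_distrib]
  refine Finset.sum_eq_zero fun c _ => ?_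
  have h := congrArg Polynomial.C (tc_cyc a b c)
  rw [map_add, map_add, map_zero] at h
  linear_combination x a * (y b * z c) * h

/-- The concrete data. -/
noncomputable def cND : ND PV PV (Polynomial RR) where
  DV := derV
  DW := derV
  DZ := AddMonoidHom.mk' (fun z => Polynomial.derivative z) (by simp)
  B := AddMonoidHom.mk' (fun v => AddMonoidHom.mk' (fun v' => bet v v') (by
      intro x y; ext1 c; simp [bet, mul_add, Finset.sum_add_distrib])) (by
      intro x y; ext v' c; simp [bet, mul_add, add_mul, Finset.sum_add_distrib])
  P := AddMonoidHom.mk' (fun w => AddMonoidHom.mk' (fun v => pai w v) (by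
      intro x y; simp [pai, mul_add, Finset.sum_add_distrib])) (by
      intro x y; refine AddMonoidHom.ext fun v => ?_
      simp [pai, add_mul, Finset.sum_add_distrib])
  hB v v' := by
    ext1 c
    change derV (bet v v') c = bet (derV v) v' c + bet v (derV v') c
    simp only [derV_apply, bet, Polynomial.derivative_sum, Polynomial.derivative_mul,
      Polynomial.derivative_C, zero_mul, zero_add, mul_add, Finset.sum_add_distrib]
  hP w v := by
    change Polynomial.derivative (pai w v) = pai (derV w) v + pai w (derV v)
    simp only [derV_apply, pai, Polynomial.derivative_sum,
      Polynomial.derivative_mul, Finset.sum_add_distrib]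
  alt v := bet_alt v
  cyc x y z := pai_cyc x y z

theorem cf_bet (v v' : PV) (j : ℕ) (u : VV) : ∑ c, cf (bet v v') j c * u c =
    ∑ p ∈ Finset.HasAntidiagonal.antidiagonal j, tau (cf v p.1) (cf v' p.2) u := by
  simp only [cf, bet, tau, Polynomial.finsetSum_coeff, Polynomial.coeff_C_mul]
  simp only [Polynomial.coeff_mul, Finset.sum_mul, Finset.mul_sum]
  rw [← sum_rot (fun a b c => _)]
  symm
  rw [Finset.sum_comm]
  refine Finset.sum_congr rfl fun a _ => ?_
  rw [Finset.sum_comm]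
  refine Finset.sum_congr rfl fun b _ => ?_
  rw [Finset.sum_comm]
  refine Finset.sum_congr rfl fun c _ => Finset.sum_congr rfl fun p _ => by ring

theorem cf_pai (w v : PV) (j : ℕ) : (pai w v).coeff j =
    ∑ p ∈ Finset.HasAntidiagonal.antidiagonal j, ∑ c, cf w p.1 c * cf v p.2 c := by
  simp only [pai, cf, Polynomial.finsetSum_coeff, Polynomial.coeff_mul]
  rw [Finset.sum_comm]

theorem cf_der (v : PV) (j : ℕ) : cf (derV v) j = ((j + 1 : ℕ) : RR) • cf v (j + 1) := by
  ext1 a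
  simp [cf, derV_apply, Polynomial.coeff_derivative, mul_comm]

theorem cf_add (v w : PV) (j : ℕ) : cf (v + w) j = cf v j + cf w j := by
  ext1 a; simp [cf]

theorem cf_neg (v : PV) (j : ℕ) : cf (-v) j = - cf v j := by
  ext1 a; simp [cf]

theorem cf_zero (j : ℕ) : cf 0 j = 0 := by
  ext1 a; simp [cf]

/-- The concrete filtration. -/
noncomputable def cFil : NFil cND where
  FV k :=
    { carrier := {v | ∀ j, cf v j ∈ Vf (k + j)}
      zero_mem' := by intro j; rw [cf_zero]; exact zero_mem _
      add_mem' := by intro x y hx hy j; rw [cf_add]; exact add_mem (hx j) (hy j)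
      neg_mem' := by intro x hx j; rw [cf_neg]; exact neg_mem (hx j) }
  FW k :=
    { carrier := {w | ∀ j n, 7 ≤ k + j + n → ∀ u ∈ Vf n, ∑ c, cf w j c * u c = 0}
      zero_mem' := by intro j n _ u _; simp [cf_zero]
      add_mem' := by
        intro x y hx hy j n h u hu
        simp only [cf_add, Pi.add_apply, add_mul, Finset.sum_add_distrib, hx j n h u hu,
          hy j n h u hu, add_zero]
      neg_mem' := by
        intro x hx j n h u hu
        simp only [cf_neg, Pi.neg_apply, neg_mul, Finset.sum_neg_distrib, hx j n h u hu, neg_zero] }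
  FZ k :=
    { carrier := {z | ∀ j, 7 ≤ k + j → z.coeff j = 0}
      zero_mem' := by intro j _; simp
      add_mem' := by intro x y hx hy j h; simp [hx j h, hy j h]
      neg_mem' := by intro x hx j h; simp [hx j h] }
  aV k v h j := Vf_anti (by omega) (h j)
  aW k w h j n hn u hu := h j n (by omega) u hu
  aZ k z h j hj := h j (by omega)
  dV k v h j := by
    change cf (derV v) j ∈ _
    rw [cf_der]
    refine Submodule.smul_mem _ _ ?_
    have := h (j + 1)
    rwa [show k + (j + 1) = k + 1 + j by omega] at this
  dW k w h j n hn u hu := by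
    change ∑ c, cf (derV w) j c * u c = 0
    rw [cf_der]
    simp only [Pi.smul_apply, smul_eq_mul, mul_assoc, ← Finset.mul_sum]
    rw [h (j + 1) n (by omega) u hu, mul_zero]
  dZ k z h j hj := by
    change (Polynomial.derivative z).coeff j = 0
    rw [Polynomial.coeff_derivative, h (j + 1) (by omega), zero_mul]
  bB m k v v' hv hv' j n hn u hu := by
    change ∑ c, cf (bet v v') j c * u c = 0
    rw [cf_bet]
    refine Finset.sum_eq_zero fun p hp => ?_
    rw [Finset.HasAntidiagonal.mem_antidiagonal] at hp
    exact tau_Vf (by omega) (hv p.1) (hv' p.2) hu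
  bP m k w v hw hv j hj := by
    change (pai w v).coeff j = 0
    rw [cf_pai]
    refine Finset.sum_eq_zero fun p hp => ?_
    rw [Finset.HasAntidiagonal.mem_antidiagonal] at hp
    exact hw p.1 (k + p.2) (by omega) _ (hv p.2)

/-- Constant polynomial vectors times a power of the variable. -/
noncomputable def mono (n : ℕ) : VV →+ PV :=
  AddMonoidHom.mk' (fun v a => Polynomial.monomial n (v a)) (by intros; ext1; simp)

theorem cf_mono (n j : ℕ) (v : VV) : cf (mono n v) j = if n = j then v else 0 := by
  ext1 a
  by_cases h : n = j <;> simp [cf, mono, Polynomial.coeff_monomial, h]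

theorem der_mono (n : ℕ) (v : VV) :
    derV (mono (n + 1) v) = mono n (((n + 1 : ℕ) : RR) • v) := by
  ext1 a
  simp [derV_apply, mono, mul_comm]

theorem inV_mono_mem {k n : ℕ} {v : VV} (h : v ∈ Vf (k + n)) :
    (NN.inV (mono n v) : NN cND) ∈ cFil.F k := by
  refine ⟨fun _ => rfl, ?_, zero_mem _, zero_mem _⟩
  intro j
  change cf (mono n v) j ∈ _
  rw [cf_mono]
  split_ifs with hj
  · subst hj; exact h
  · exact zero_mem _

theorem dd_mem : (NN.dd : NN cND) ∈ cFil.F 1 :=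
  ⟨by omega, zero_mem _, zero_mem _, zero_mem _⟩

/-- Index of the basis vector for `e_i`. -/
def ix (i : Fin 4) : Fin 8 := Fin.castLE (by omega) i

/-- Index of the basis vector for `y_{ij}`. -/
def iy (i : Fin 4) : Fin 8 := Fin.natAdd 4 i

theorem bas_x_mem (i : Fin 4) : bas (ix i) ∈ Vf 1 := by
  refine Submodule.subset_span ⟨(1, [(1, ix i)]), ?_, le_rfl, by simp [vec]⟩
  fin_cases i <;> simp [gensL, ix]

theorem bas_y_mem (i : Fin 4) : bas (iy i) ∈ Vf 3 := by
  refine Submodule.subset_span ⟨(3, [(1, iy i)]), ?_, le_rfl, by simp [vec]⟩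
  fin_cases i <;> simp [gensL, iy]

theorem bas_z_mem (i : Fin 4) : ((3 : RR) ^ (2 * (i : ℕ))) • bas (ix i) ∈ Vf 2 := by
  refine Submodule.subset_span ⟨(2, [(3 ^ (2 * (i : ℕ)), ix i)]), ?_, le_rfl, by simp [vec]⟩
  fin_cases i <;> simp [gensL, ix]

theorem rel_mem (k : Fin 4) :
    ((3 : RR) ^ (12 - ((pairIdx k).1 : ℕ))) • bas (ix (pairIdx k).2)
      + ((3 : RR) ^ (12 - ((pairIdx k).2 : ℕ))) • bas (ix (pairIdx k).1)
      - ((3 : RR) ^ (12 - 2 * ((pairIdx k).1 : ℕ) - 2 * ((pairIdx k).2 : ℕ))) • bas (iy k)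
      ∈ Vf 7 := by
  refine Submodule.subset_span ⟨(7, [(3 ^ (12 - ((pairIdx k).1 : ℕ)), ix (pairIdx k).2),
    (3 ^ (12 - ((pairIdx k).2 : ℕ)), ix (pairIdx k).1),
    (- 3 ^ (12 - 2 * ((pairIdx k).1 : ℕ) - 2 * ((pairIdx k).2 : ℕ)), iy k)]), ?_, le_rfl, ?_⟩
  · fin_cases k <;> decide
  · simp [vec, sub_eq_add_neg, add_assoc]

/-- The images of the generators. -/
noncomputable def gg : TGen → NN cND
  | Sum.inl i => NN.inV (mono 0 (bas (ix i)))
  | Sum.inr (Sum.inl (i, p)) =>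
      if p = 0 then NN.inV (mono 1 (((3 : RR) ^ (2 * (i : ℕ))) • bas (ix i))) else NN.dd
  | Sum.inr (Sum.inr (k, p)) =>
      if p = 0 then NN.inV (mono 2 (half • bas (iy k))) else NN.dd

theorem gg_mem : ∀ x, gg x ∈ cFil.F 1 := by
  rintro (i | ⟨i, p⟩ | ⟨k, p⟩)
  · exact inV_mono_mem (bas_x_mem i)
  · dsimp only [gg]
    split_ifs
    · exact inV_mono_mem (bas_z_mem i)
    · exact dd_mem
  · dsimp only [gg]
    split_ifs
    · exact inV_mono_mem (Submodule.smul_mem _ _ (bas_y_mem k))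
    · exact dd_mem

/-- The homomorphism. -/
noncomputable def ff : FreeLieAlgebra ℤ TGen →ₗ⁅ℤ⁆ NN cND := cFil.hom gg gg_mem

theorem ff_e (i : Fin 4) : ff (eF i) = NN.inV (mono 0 (bas (ix i))) :=
  cFil.hom_of gg gg_mem _

theorem ff_y (i : Fin 4) :
    ff (yF i) = NN.inV (mono 0 (((3 : RR) ^ (2 * (i : ℕ))) • bas (ix i))) := by
  have h0 : ff (FreeLieAlgebra.of ℤ ((Sum.inr (Sum.inl (i, 0)) : TGen))) =
    NN.inV (mono 1 (((3 : RR) ^ (2 * (i : ℕ))) • bas (ix i))) := cFil.hom_of gg gg_mem _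
  have h1 : ff (FreeLieAlgebra.of ℤ ((Sum.inr (Sum.inl (i, 1)) : TGen))) =
    NN.dd := cFil.hom_of gg gg_mem _
  rw [yF, LieHom.map_lie, h0, h1, NN.lie_dd]
  change NN.inV (derV _) = _
  rw [der_mono]; simp

theorem ff_yy (k : Fin 4) : ff (yyF k) = NN.inV (mono 0 (bas (iy k))) := by
  have h0 : ff (FreeLieAlgebra.of ℤ ((Sum.inr (Sum.inr (k, 0)) : TGen))) =
    NN.inV (mono 2 (half • bas (iy k))) := cFil.hom_of gg gg_mem _
  have h1 : ff (FreeLieAlgebra.of ℤ ((Sum.inr (Sum.inr (k, 1)) : TGen))) =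
    NN.dd := cFil.hom_of gg gg_mem _
  have h2 : ff (FreeLieAlgebra.of ℤ ((Sum.inr (Sum.inr (k, 2)) : TGen))) =
    NN.dd := cFil.hom_of gg gg_mem _
  rw [yyF, LieHom.map_lie, LieHom.map_lie, h0, h1, h2, NN.lie_dd, NN.lie_dd]
  change NN.inV (derV (derV _)) = _
  rw [der_mono, der_mono, smul_smul, smul_smul]
  congr 2
  have := half_two
  rw [show ((0 + 1 : ℕ) : RR) * ((1 + 1 : ℕ) : RR) * half = 1 by
    push_cast; linear_combination this, one_smul]

theorem zs (n : ℕ) (v : VV) : ((3 ^ n : ℤ)) • (NN.inV (mono 0 v) : NN cND) =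
    NN.inV (mono 0 (((3 : RR) ^ n) • v)) := by
  rw [← map_zsmul, ← map_zsmul]
  congr 2
  ext1 a
  simp

theorem ff_smul (n : ℤ) (x) : ff (n • x) = n • ff x := map_zsmul ff n x

theorem ff_rel : ∀ v ∈ tRels, ff v ∈ cFil.F 7 := by
  rintro v (⟨i, rfl⟩ | ⟨k, rfl⟩)
  · rw [map_sub, map_smul, ff_e, ff_y, zs, sub_self]
    exact zero_mem _
  · rw [map_sub, map_add, map_smul, map_smul, map_smul, ff_e, ff_e, ff_yy, zs, zs, zs, ← map_add,
      ← map_add, ← map_sub, ← map_sub]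
    exact inV_mono_mem (rel_mem k)

theorem t_two : ((3 ^ 9 : ℤ) • ⁅⁅eT 2, eT 1⁆, eT 0⁆) ∉ gammaLie TLie 7 := by
  intro h
  have e : tmk ((3 ^ 9 : ℤ) • ⁅⁅eF 2, eF 1⁆, eF 0⁆) = (3 ^ 9 : ℤ) • ⁅⁅eT 2, eT 1⁆, eT 0⁆ := by
    rw [map_smul, LieHom.map_lie, LieHom.map_lie]; rfl
  rw [← e] at h
  have h2 : ff ((3 ^ 9 : ℤ) • ⁅⁅eF 2, eF 1⁆, eF 0⁆) ∈ cFil.F 7 :=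
    part_two_abs cFil gg gg_mem ff_rel _ h
  rw [map_smul, LieHom.map_lie, LieHom.map_lie, ff_e, ff_e, ff_e, NN.lie_three, ← map_zsmul] at h2
  have h3 := h2.2.2.2 0 le_rfl
  change ((3 ^ 9 : ℤ) • pai (bet (mono 0 (bas (ix 2))) (mono 0 (bas (ix 1))))
    (mono 0 (bas (ix 0)))).coeff 0 = 0 at h3
  have h4 : (pai (bet (mono 0 (bas (ix 2))) (mono 0 (bas (ix 1))))
    (mono 0 (bas (ix 0)))).coeff 0 = tc 2 1 0 := by
    rw [cf_pai]
    simp only [Finset.HasAntidiagonal.antidiagonal_zero, Finset.sum_singleton]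
    rw [cf_bet]
    simp only [Finset.HasAntidiagonal.antidiagonal_zero, Finset.sum_singleton]
    rw [cf_mono, cf_mono, cf_mono, if_pos rfl, if_pos rfl, if_pos rfl, tau_bas]
    rfl
  rw [Polynomial.coeff_smul, h4, tc, zsmul_eq_mul, ← Int.cast_mul,
    ZMod.intCast_zmod_eq_zero_iff_dvd] at h3
  revert h3
  decide +kernel

/-- The element `ω = 3⁹·⁅⁅e_2, e_1⁆, e_0⁆` lies in `δ_7(A)`, does not lie in `γ_7(A)`,
and `3·ω` lies in `γ_7(A)`. -/
theorem three_torsion_lie_example :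
    ((3 ^ 9 : ℤ) • ⁅⁅eT 2, eT 1⁆, eT 0⁆) ∈ dimensionSubring TLie 7 ∧
    ((3 ^ 9 : ℤ) • ⁅⁅eT 2, eT 1⁆, eT 0⁆) ∉ gammaLie TLie 7 ∧
    (3 : ℤ) • ((3 ^ 9 : ℤ) • ⁅⁅eT 2, eT 1⁆, eT 0⁆) ∈ gammaLie TLie 7 := by
  exact ⟨t_one, t_two, t_three⟩
end

section
/- For every integer n ≥ 4 there exist a Lie ring A (a Lie algebra over ℤ) and an element a ∈ A such that a ∈ δ_n(A), a ∉ γ_n(A), and 2·a ∈ γ_n(A); that is, the dimension quotient δ_n(A)/γ_n(A) contains an element of order 2. -/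
/-- powers of the augmentation ideal -/
noncomputable def augPow (A : Type*) [LieRing A] [LieAlgebra ℤ A] (n : ℕ) :
    Submodule ℤ (UniversalEnvelopingAlgebra ℤ A) := (augIdealLie A) ^ n

theorem augPow_one {A : Type*} [LieRing A] [LieAlgebra ℤ A] (a : A) :
    UniversalEnvelopingAlgebra.ι ℤ a ∈ augPow A 1 := by
  unfold augPow
  rw [Submodule.pow_one]
  exact Submodule.subset_span ⟨1, 1, a, by simp⟩

theorem augPow_mul {A : Type*} [LieRing A] [LieAlgebra ℤ A] {m n : ℕ} (hn : n ≠ 0)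
    {x y : UniversalEnvelopingAlgebra ℤ A} (hx : x ∈ augPow A m) (hy : y ∈ augPow A n) :
    x * y ∈ augPow A (m + n) := by
  unfold augPow at *
  rw [Submodule.pow_add _ hn]
  exact Submodule.mul_mem_mul hx hy

theorem mem_dim_of {A : Type*} [LieRing A] [LieAlgebra ℤ A] {n : ℕ} {a : A}
    (h : UniversalEnvelopingAlgebra.ι ℤ a ∈ augPow A n) : a ∈ dimensionSubring A n := h

/-- Underlying module of the auxiliary Lie ring: coordinates `x1,x2,x3,s` and `f1,f2,f3,g`. -/
@[ext] structure LRing (k : ℕ) where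
  x1 : ℤ
  x2 : ℤ
  x3 : ℤ
  s : ℤ
  f1 : Fin k → ZMod 256
  f2 : Fin k → ZMod 256
  f3 : Fin k → ZMod 256
  g : Fin k → ZMod 256

namespace LRing

variable {k : ℕ}

/-- coordinates -/
def toProd (a : LRing k) : ℤ × ℤ × ℤ × ℤ × (Fin k → ZMod 256) × (Fin k → ZMod 256) ×
    (Fin k → ZMod 256) × (Fin k → ZMod 256) :=
  (a.x1, a.x2, a.x3, a.s, a.f1, a.f2, a.f3, a.g)

theorem toProd_inj : Function.Injective (toProd (k := k)) := by
  intro a b h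
  simp only [toProd, Prod.mk.injEq] at h
  obtain ⟨h1, h2, h3, h4, h5, h6, h7, h8⟩ := h
  exact LRing.ext h1 h2 h3 h4 h5 h6 h7 h8

instance : Zero (LRing k) := ⟨⟨0, 0, 0, 0, 0, 0, 0, 0⟩⟩
instance : Add (LRing k) := ⟨fun a b => ⟨a.x1 + b.x1, a.x2 + b.x2, a.x3 + b.x3, a.s + b.s,
  a.f1 + b.f1, a.f2 + b.f2, a.f3 + b.f3, a.g + b.g⟩⟩
instance : Neg (LRing k) := ⟨fun a => ⟨-a.x1, -a.x2, -a.x3, -a.s, -a.f1, -a.f2, -a.f3, -a.g⟩⟩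
instance : Sub (LRing k) := ⟨fun a b => ⟨a.x1 - b.x1, a.x2 - b.x2, a.x3 - b.x3, a.s - b.s,
  a.f1 - b.f1, a.f2 - b.f2, a.f3 - b.f3, a.g - b.g⟩⟩
instance : SMul ℕ (LRing k) := ⟨fun n a => ⟨n • a.x1, n • a.x2, n • a.x3, n • a.s,
  n • a.f1, n • a.f2, n • a.f3, n • a.g⟩⟩
instance : SMul ℤ (LRing k) := ⟨fun n a => ⟨n • a.x1, n • a.x2, n • a.x3, n • a.s,
  n • a.f1, n • a.f2, n • a.f3, n • a.g⟩⟩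

instance : AddCommGroup (LRing k) :=
  Function.Injective.addCommGroup toProd toProd_inj rfl (fun _ _ => rfl) (fun _ => rfl)
    (fun _ _ => rfl) (fun _ _ => rfl) (fun _ _ => rfl)

section lems
variable (a b : LRing k) (n : ℤ)
@[simp] theorem zero_x1 : (0 : LRing k).x1 = 0 := rfl
@[simp] theorem zero_x2 : (0 : LRing k).x2 = 0 := rfl
@[simp] theorem zero_x3 : (0 : LRing k).x3 = 0 := rfl
@[simp] theorem zero_s : (0 : LRing k).s = 0 := rfl
@[simp] theorem zero_f1 : (0 : LRing k).f1 = 0 := rfl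
@[simp] theorem zero_f2 : (0 : LRing k).f2 = 0 := rfl
@[simp] theorem zero_f3 : (0 : LRing k).f3 = 0 := rfl
@[simp] theorem zero_g : (0 : LRing k).g = 0 := rfl
@[simp] theorem add_x1 : (a + b).x1 = a.x1 + b.x1 := rfl
@[simp] theorem add_x2 : (a + b).x2 = a.x2 + b.x2 := rfl
@[simp] theorem add_x3 : (a + b).x3 = a.x3 + b.x3 := rfl
@[simp] theorem add_s : (a + b).s = a.s + b.s := rfl
@[simp] theorem add_f1 : (a + b).f1 = a.f1 + b.f1 := rfl
@[simp] theorem add_f2 : (a + b).f2 = a.f2 + b.f2 := rfl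
@[simp] theorem add_f3 : (a + b).f3 = a.f3 + b.f3 := rfl
@[simp] theorem add_g : (a + b).g = a.g + b.g := rfl
@[simp] theorem neg_x1 : (-a).x1 = -a.x1 := rfl
@[simp] theorem neg_x2 : (-a).x2 = -a.x2 := rfl
@[simp] theorem neg_x3 : (-a).x3 = -a.x3 := rfl
@[simp] theorem neg_s : (-a).s = -a.s := rfl
@[simp] theorem neg_f1 : (-a).f1 = -a.f1 := rfl
@[simp] theorem neg_f2 : (-a).f2 = -a.f2 := rfl
@[simp] theorem neg_f3 : (-a).f3 = -a.f3 := rfl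
@[simp] theorem neg_g : (-a).g = -a.g := rfl
@[simp] theorem sub_x1 : (a - b).x1 = a.x1 - b.x1 := rfl
@[simp] theorem sub_x2 : (a - b).x2 = a.x2 - b.x2 := rfl
@[simp] theorem sub_x3 : (a - b).x3 = a.x3 - b.x3 := rfl
@[simp] theorem sub_s : (a - b).s = a.s - b.s := rfl
@[simp] theorem sub_f1 : (a - b).f1 = a.f1 - b.f1 := rfl
@[simp] theorem sub_f2 : (a - b).f2 = a.f2 - b.f2 := rfl
@[simp] theorem sub_f3 : (a - b).f3 = a.f3 - b.f3 := rfl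
@[simp] theorem sub_g : (a - b).g = a.g - b.g := rfl
@[simp] theorem smul_x1 : (n • a).x1 = n * a.x1 := rfl
@[simp] theorem smul_x2 : (n • a).x2 = n * a.x2 := rfl
@[simp] theorem smul_x3 : (n • a).x3 = n * a.x3 := rfl
@[simp] theorem smul_s : (n • a).s = n * a.s := rfl
@[simp] theorem smul_f1 : (n • a).f1 = n • a.f1 := rfl
@[simp] theorem smul_f2 : (n • a).f2 = n • a.f2 := rfl
@[simp] theorem smul_f3 : (n • a).f3 = n • a.f3 := rfl
@[simp] theorem smul_g : (n • a).g = n • a.g := rfl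
end lems

/-- truncated shift -/
def T (f : Fin k → ZMod 256) : Fin k → ZMod 256 :=
  fun j => if h : j.val + 1 < k then f ⟨j.val + 1, h⟩ else 0

/-- the delta function at `0` -/
def e : Fin k → ZMod 256 := fun j => if j.val = 0 then 1 else 0

instance : Bracket (LRing k) (LRing k) := ⟨fun a b =>
  ⟨0, 0, 0, 0,
   fun j => a.s * T b.f1 j - b.s * T a.f1 j,
   fun j => a.s * T b.f2 j - b.s * T a.f2 j,
   fun j => a.s * T b.f3 j - b.s * T a.f3 j,
   fun j => a.s * T b.g j - b.s * T a.g j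
     + 64 * (a.x1 * b.f1 j - b.x1 * a.f1 j)
     + 16 * (a.x2 * b.f2 j - b.x2 * a.f2 j)
     + 4 * (a.x3 * b.f3 j - b.x3 * a.f3 j)
     + e j * (4 * (a.x1 * b.x2 - a.x2 * b.x1) + 2 * (a.x1 * b.x3 - a.x3 * b.x1)
        + (a.x2 * b.x3 - a.x3 * b.x2))⟩⟩

section lems2
variable (a b : LRing k) (j : Fin k)
@[simp] theorem lie_x1 : ⁅a, b⁆.x1 = 0 := rfl
@[simp] theorem lie_x2 : ⁅a, b⁆.x2 = 0 := rfl
@[simp] theorem lie_x3 : ⁅a, b⁆.x3 = 0 := rfl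
@[simp] theorem lie_s : ⁅a, b⁆.s = 0 := rfl
@[simp] theorem lie_f1 : ⁅a, b⁆.f1 j = a.s * T b.f1 j - b.s * T a.f1 j := rfl
@[simp] theorem lie_f2 : ⁅a, b⁆.f2 j = a.s * T b.f2 j - b.s * T a.f2 j := rfl
@[simp] theorem lie_f3 : ⁅a, b⁆.f3 j = a.s * T b.f3 j - b.s * T a.f3 j := rfl
@[simp] theorem lie_g : ⁅a, b⁆.g j = a.s * T b.g j - b.s * T a.g j
     + 64 * (a.x1 * b.f1 j - b.x1 * a.f1 j)
     + 16 * (a.x2 * b.f2 j - b.x2 * a.f2 j)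
     + 4 * (a.x3 * b.f3 j - b.x3 * a.f3 j)
     + e j * (4 * (a.x1 * b.x2 - a.x2 * b.x1) + 2 * (a.x1 * b.x3 - a.x3 * b.x1)
        + (a.x2 * b.x3 - a.x3 * b.x2)) := rfl
end lems2

theorem T_add (f f' : Fin k → ZMod 256) (j : Fin k) : T (f + f') j = T f j + T f' j := by
  unfold T; split_ifs <;> simp

theorem T_lie_f1 (a b : LRing k) (j : Fin k) :
    T ⁅a, b⁆.f1 j = a.s * T (T b.f1) j - b.s * T (T a.f1) j := by
  by_cases h : j.val + 1 < k
  · conv_lhs => unfold T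
    conv_rhs => rw [T, T]
    simp only [h, dif_pos, lie_f1]
  · simp [T, h]

theorem T_lie_f2 (a b : LRing k) (j : Fin k) :
    T ⁅a, b⁆.f2 j = a.s * T (T b.f2) j - b.s * T (T a.f2) j := by
  by_cases h : j.val + 1 < k
  · conv_lhs => unfold T
    conv_rhs => rw [T, T]
    simp only [h, dif_pos, lie_f2]
  · simp [T, h]

theorem T_lie_f3 (a b : LRing k) (j : Fin k) :
    T ⁅a, b⁆.f3 j = a.s * T (T b.f3) j - b.s * T (T a.f3) j := by
  by_cases h : j.val + 1 < k
  · conv_lhs => unfold T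
    conv_rhs => rw [T, T]
    simp only [h, dif_pos, lie_f3]
  · simp [T, h]

theorem T_lie_g (a b : LRing k) (j : Fin k) :
    T ⁅a, b⁆.g j = a.s * T (T b.g) j - b.s * T (T a.g) j
     + 64 * (a.x1 * T b.f1 j - b.x1 * T a.f1 j)
     + 16 * (a.x2 * T b.f2 j - b.x2 * T a.f2 j)
     + 4 * (a.x3 * T b.f3 j - b.x3 * T a.f3 j) := by
  have h0 : ∀ f : Fin k → ZMod 256, T f j = if h : j.val + 1 < k then f ⟨j.val + 1, h⟩ else 0 :=
    fun _ => rfl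
  simp only [h0]
  by_cases h : j.val + 1 < k
  · simp only [h, dif_pos, lie_g]
    simp [e]
  · simp [h]

instance : LieRing (LRing k) where
  add_lie a b c := by
    ext <;> simp [T_add] <;> ring
  lie_add a b c := by
    ext <;> simp [T_add] <;> ring
  lie_self a := by
    ext <;> simp <;> ring
  leibniz_lie a b c := by
    ext j <;> simp [T_lie_f1, T_lie_f2, T_lie_f3, T_lie_g] <;> ring

/-- The filtration bounding the lower central series. -/
def N (k m : ℕ) : LieSubmodule ℤ (LRing k) (LRing k) where
  carrier := {a | (1 ≤ m → a.x1 = 0 ∧ a.x2 = 0 ∧ a.x3 = 0 ∧ a.s = 0) ∧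
    (∀ j : Fin k, k ≤ j.val + m → a.f1 j = 0 ∧ a.f2 j = 0 ∧ a.f3 j = 0) ∧
    (∀ j : Fin k, k + 1 ≤ j.val + m → a.g j = 0)}
  zero_mem' := by simp
  add_mem' := by
    rintro a b ⟨h1, h2, h3⟩ ⟨h1', h2', h3'⟩
    refine ⟨fun h => ?_, fun j h => ?_, fun j h => ?_⟩
    · simp [h1 h, h1' h]
    · simp [h2 j h, h2' j h]
    · simp [h3 j h, h3' j h]
  smul_mem' := by
    rintro c a ⟨h1, h2, h3⟩
    refine ⟨fun h => ?_, fun j h => ?_, fun j h => ?_⟩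
    · simp [h1 h]
    · simp [h2 j h]
    · simp [h3 j h]
  lie_mem := by
    rintro b a ⟨h1, h2, h3⟩
    rcases Nat.eq_zero_or_pos m with rfl | hm
    · refine ⟨fun h => ?_, fun j h => ?_, fun j h => ?_⟩
      · omega
      · have := j.2; omega
      · have := j.2; omega
    obtain ⟨hx1, hx2, hx3, hs⟩ := h1 hm
    refine ⟨fun h => ?_, fun j h => ?_, fun j h => ?_⟩
    · simp
    · simp only [lie_f1, lie_f2, lie_f3, hs, T]
      by_cases hj : j.val + 1 < k
      · simp [hj, h2 ⟨j.val + 1, hj⟩ (by simp; omega)]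
      · simp [hj]
    · simp only [lie_g, hs, hx1, hx2, hx3, h2 j (by omega), T]
      by_cases hj : j.val + 1 < k
      · simp [hj, h3 ⟨j.val + 1, hj⟩ (by simp; omega)]
      · simp [hj]

theorem lcs_le (m : ℕ) : LieModule.lowerCentralSeries ℤ (LRing k) (LRing k) m ≤ N k m := by
  induction m with
  | zero =>
    rintro a -
    refine ⟨fun h => ?_, fun j h => ?_, fun j h => ?_⟩
    · omega
    · have := j.2; omega
    · have := j.2; omega
  | succ m ih =>
    rw [LieModule.lowerCentralSeries_succ, LieSubmodule.lieIdeal_oper_eq_span,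
      LieSubmodule.lieSpan_le]
    rintro _ ⟨⟨b, -⟩, ⟨a, ha⟩, rfl⟩
    obtain ⟨h1, h2, h3⟩ := ih ha
    change ⁅b, a⁆ ∈ N k (m + 1)
    refine ⟨fun h => by simp, fun j h => ?_, fun j h => ?_⟩
    · rcases Nat.eq_zero_or_pos m with rfl | hm
      · have hj : ¬ j.val + 1 < k := by omega
        simp [T, hj]
      obtain ⟨hx1, hx2, hx3, hs⟩ := h1 hm
      simp only [lie_f1, lie_f2, lie_f3, hs, T]
      by_cases hj : j.val + 1 < k
      · simp [hj, h2 ⟨j.val + 1, hj⟩ (by simp; omega)]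
      · simp [hj]
    · rcases Nat.eq_zero_or_pos m with rfl | hm
      · have := j.2; omega
      obtain ⟨hx1, hx2, hx3, hs⟩ := h1 hm
      simp only [lie_g, hs, hx1, hx2, hx3, h2 j (by omega), T]
      by_cases hj : j.val + 1 < k
      · simp [hj, h3 ⟨j.val + 1, hj⟩ (by simp; omega)]
      · simp [hj]

theorem lcs_top : LieModule.lowerCentralSeries ℤ (LRing k) (LRing k) (k + 1) = ⊥ := by
  rw [eq_bot_iff]
  intro a ha
  obtain ⟨h1, h2, h3⟩ := lcs_le _ ha
  obtain ⟨hx1, hx2, hx3, hs⟩ := h1 (by omega)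
  rw [LieSubmodule.mem_bot]
  ext j
  · exact hx1
  · exact hx2
  · exact hx3
  · exact hs
  · exact (h2 j (by omega)).1
  · exact (h2 j (by omega)).2.1
  · exact (h2 j (by omega)).2.2
  · exact h3 j (by omega)

/-- The ideal of relations `4 x1 = c1`, `16 x2 = c2`, `64 x3 = c3`,
`4 f1 = 0`, `16 f2 = 0`, `64 f3 = 0`, where `c1 = (0,-1,-2)`, `c2 = (1,0,-4)`, `c3 = (2,4,0)`. -/
def I (k : ℕ) : LieIdeal ℤ (LRing k) where
  carrier := {a | ∃ (p q r : ℤ) (u v w : Fin k → ZMod 256),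
    a.x1 = 4 * p ∧ a.x2 = 16 * q ∧ a.x3 = 64 * r ∧ a.s = 0 ∧ (∀ j, a.g j = 0) ∧
    (∀ j, a.f1 j = 4 * u j - e j * (q + 2 * r)) ∧
    (∀ j, a.f2 j = 16 * v j - e j * (-p + 4 * r)) ∧
    (∀ j, a.f3 j = 64 * w j - e j * (-2 * p - 4 * q))}
  zero_mem' := ⟨0, 0, 0, 0, 0, 0, by simp⟩
  add_mem' := by
    rintro a b ⟨p, q, r, u, v, w, h1, h2, h3, h4, h5, h6, h7, h8⟩
      ⟨p', q', r', u', v', w', h1', h2', h3', h4', h5', h6', h7', h8'⟩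
    refine ⟨p + p', q + q', r + r', u + u', v + v', w + w', ?_, ?_, ?_, ?_, ?_, ?_, ?_, ?_⟩
    · simp [h1, h1']; ring
    · simp [h2, h2']; ring
    · simp [h3, h3']; ring
    · simp [h4, h4']
    · simp [h5, h5']
    · intro j; simp [h6, h6']; ring
    · intro j; simp [h7, h7']; ring
    · intro j; simp [h8, h8']; ring
  smul_mem' := by
    rintro c a ⟨p, q, r, u, v, w, h1, h2, h3, h4, h5, h6, h7, h8⟩
    refine ⟨c * p, c * q, c * r, c • u, c • v, c • w, ?_, ?_, ?_, ?_, ?_, ?_, ?_, ?_⟩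
    · simp [h1]; ring
    · simp [h2]; ring
    · simp [h3]; ring
    · simp [h4]
    · simp [h5]
    · intro j; simp [h6]; ring
    · intro j; simp [h7]; ring
    · intro j; simp [h8]; ring
  lie_mem := by
    rintro b a ⟨p, q, r, u, v, w, h1, h2, h3, h4, h5, h6, h7, h8⟩
    refine ⟨0, 0, 0, fun j => b.s * T u j, fun j => b.s * T v j, fun j => b.s * T w j,
      ?_, ?_, ?_, ?_, ?_, ?_, ?_, ?_⟩
    · simp
    · simp
    · simp
    · simp
    · intro j
      have h256 : (256 : ZMod 256) = 0 := by decide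
      have hT : T a.g j = 0 := by unfold T; split_ifs <;> simp [h5]
      simp only [lie_g, h1, h2, h3, h4, h5, h6, h7, h8, hT]
      push_cast
      linear_combination (b.x1 * u j - p * b.f1 j - q * b.f2 j + b.x2 * v j
        + b.x3 * w j - r * b.f3 j) * h256
    · intro j
      simp only [lie_f1, h4, T]
      split_ifs
      · simp [h6, e]; ring
      · simp
    · intro j
      simp only [lie_f2, h4, T]
      split_ifs
      · simp [h7, e]; ring
      · simp
    · intro j
      simp only [lie_f3, h4, T]
      split_ifs
      · simp [h8, e]; ring
      · simp

/-- element with given `f`-part -/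
def Y (f1 f2 f3 : Fin k → ZMod 256) : LRing k := ⟨0, 0, 0, 0, f1, f2, f3, 0⟩
/-- generator -/
def X1 : LRing k := ⟨1, 0, 0, 0, 0, 0, 0, 0⟩
/-- generator -/
def X2 : LRing k := ⟨0, 1, 0, 0, 0, 0, 0, 0⟩
/-- generator -/
def X3 : LRing k := ⟨0, 0, 1, 0, 0, 0, 0, 0⟩
/-- generator -/
def S : LRing k := ⟨0, 0, 0, 1, 0, 0, 0, 0⟩
/-- the vector `(a,b,c) e` -/
def V (a b c : ℤ) : LRing k := Y (fun j => a * e j) (fun j => b * e j) (fun j => c * e j)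
/-- the witness -/
def W : LRing k := (32 : ℤ) • ⁅(X1 : LRing k), X2⁆ + (64 : ℤ) • ⁅(X1 : LRing k), X3⁆
  + (128 : ℤ) • ⁅(X2 : LRing k), X3⁆

theorem W_eq : (W : LRing k) = ⟨0, 0, 0, 0, 0, 0, 0, fun j => 128 * e j⟩ := by
  have h256 : (256 : ZMod 256) = 0 := by decide
  have hT : ∀ j : Fin k, T (0 : Fin k → ZMod 256) j = 0 := by intro j; unfold T; split_ifs <;> simp
  ext j <;> simp [W, X1, X2, X3, hT]
  linear_combination (e j) * h256

theorem W_not_mem (hk : 0 < k) : (W : LRing k) ∉ I k := by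
  rintro ⟨p, q, r, u, v, w, h1, h2, h3, h4, h5, -⟩
  have := h5 ⟨0, hk⟩
  rw [W_eq] at this
  simp [e] at this
  revert this
  decide

theorem two_W : (2 : ℤ) • (W : LRing k) = 0 := by
  have h256 : (256 : ZMod 256) = 0 := by decide
  rw [W_eq]
  ext j <;> simp
  linear_combination (e j) * h256

/-- the quotient Lie ring -/
abbrev Q (k : ℕ) := LRing k ⧸ I k

theorem mk_eq {a b : LRing k} (h : a - b ∈ I k) :
    LieSubmodule.Quotient.mk (N := I k) a = LieSubmodule.Quotient.mk b := by
  exact (Submodule.Quotient.eq _).2 h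

attribute [local instance] LieRing.ofAssociativeRing

/-- composite map to the enveloping algebra -/
noncomputable def J (k : ℕ) : LRing k →ₗ[ℤ] UniversalEnvelopingAlgebra ℤ (Q k) :=
  (UniversalEnvelopingAlgebra.ι ℤ : Q k →ₗ⁅ℤ⁆ _).toLinearMap ∘ₗ
    (LieSubmodule.Quotient.mk' (I k)).toLinearMap

theorem J_apply (a : LRing k) : J k a =
    UniversalEnvelopingAlgebra.ι ℤ (LieSubmodule.Quotient.mk a : Q k) := rfl

theorem J_lie (a b : LRing k) : J k ⁅a, b⁆ = J k a * J k b - J k b * J k a := by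
  rw [J_apply, J_apply, J_apply, LieSubmodule.Quotient.mk_bracket, LieHom.map_lie]
  rfl

theorem J_congr {a b : LRing k} (h : a - b ∈ I k) : J k a = J k b := by
  rw [J_apply, J_apply, mk_eq h]

theorem J_mem (a : LRing k) : J k a ∈ augPow (Q k) 1 := augPow_one _

theorem S_lie (f1 f2 f3 : Fin k → ZMod 256) : ⁅(S : LRing k), Y f1 f2 f3⁆ =
    Y (T f1) (T f2) (T f3) := by
  have hT : ∀ j : Fin k, T (0 : Fin k → ZMod 256) j = 0 := by intro j; unfold T; split_ifs <;> simp
  ext j <;> simp [S, Y, hT]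

theorem J_step (m : ℕ) (hm : m ≠ 0) (a b : LRing k) (h : J k b ∈ augPow (Q k) m) :
    J k ⁅a, b⁆ ∈ augPow (Q k) (m + 1) := by
  rw [J_lie]
  refine Submodule.sub_mem _ ?_ ?_
  · rw [add_comm]; exact augPow_mul hm (J_mem a) h
  · exact augPow_mul one_ne_zero h (J_mem a)

theorem J_V (a b c : ℤ) (m : ℕ) (hm : m < k) :
    J k (V a b c) ∈ augPow (Q k) (m + 1) := by
  have key : ∀ i l : ℕ, i + l < k → J k (Y (fun j => if j.val = l then (a : ZMod 256) else 0)
      (fun j => if j.val = l then (b : ZMod 256) else 0)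
      (fun j => if j.val = l then (c : ZMod 256) else 0)) ∈ augPow (Q k) (i + 1) := by
    intro i
    induction i with
    | zero => intro l _; exact J_mem _
    | succ i ih =>
      intro l hl
      have := J_step (i + 1) (by omega) S _ (ih (l + 1) (by omega))
      rw [S_lie] at this
      have hT : ∀ d : ZMod 256, T (fun j : Fin k => if j.val = l + 1 then d else 0) =
          fun j => if j.val = l then d else 0 := by
        intro d
        ext j
        unfold T
        by_cases h : j.val + 1 < k
        · simp [h]
        · have : j.val ≠ l := by omega
          simp [h, this]
      rwa [hT, hT, hT] at this
  have := key m 0 (by omega)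
  convert this using 2
  unfold V
  congr 1 <;> ext j <;> simp [e]

theorem r1 : J k ((4 : ℤ) • X1) = J k (V 0 (-1) (-2)) := by
  apply J_congr
  refine ⟨1, 0, 0, 0, 0, 0, ?_⟩
  refine ⟨?_, ?_, ?_, ?_, ?_, ?_, ?_, ?_⟩ <;> simp [X1, V, Y] <;> intros <;> ring

theorem r2 : J k ((16 : ℤ) • X2) = J k (V 1 0 (-4)) := by
  apply J_congr
  refine ⟨0, 1, 0, 0, 0, 0, ?_⟩
  refine ⟨?_, ?_, ?_, ?_, ?_, ?_, ?_, ?_⟩ <;> simp [X2, V, Y] <;> intros <;> ring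

theorem r3 : J k ((64 : ℤ) • X3) = J k (V 2 4 0) := by
  apply J_congr
  refine ⟨0, 0, 1, 0, 0, 0, ?_⟩
  refine ⟨?_, ?_, ?_, ?_, ?_, ?_, ?_, ?_⟩ <;> simp [X3, V, Y] <;> intros <;> ring

theorem rV (a b c : ℤ) : J k (V (4 * a) (16 * b) (64 * c)) = 0 := by
  rw [← map_zero (J k)]
  apply J_congr
  refine ⟨0, 0, 0, fun j => a * e j, fun j => b * e j, fun j => c * e j, ?_⟩
  refine ⟨?_, ?_, ?_, ?_, ?_, ?_, ?_, ?_⟩ <;> simp [V, Y] <;> intros <;> ring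

theorem V_add (a b c a' b' c' : ℤ) : (V (a + a') (b + b') (c + c') : LRing k) =
    V a b c + V a' b' c' := by
  ext j <;> simp [V, Y] <;> ring

theorem V_smul (n a b c : ℤ) : (V (n * a) (n * b) (n * c) : LRing k) = n • V a b c := by
  ext j <;> simp [V, Y] <;> ring

theorem J_W : J k W = J k (V 0 (-1) (-2)) * J k (V 0 1 (-2)) +
    J k (V 1 0 (-4)) * J k (V 0 0 1) := by
  have e1 := r1 (k := k)
  have e2 := r2 (k := k)
  have e3 := r3 (k := k)
  have i1 : (2 : ℤ) • J k (V 1 0 (-4)) + J k (V 2 4 0) = (4 : ℤ) • J k (V 0 1 (-2)) := by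
    rw [← map_smul, ← map_smul, ← map_add, ← V_smul, ← V_smul, ← V_add, ← sub_eq_zero, ← map_sub,
      ← rV (k := k) 1 0 0]
    congr 1
    ext j <;> simp [V, Y] <;> ring
  have i2 : (-8 : ℤ) • J k (V 0 (-1) (-2)) + (2 : ℤ) • J k (V 2 4 0)
      = (16 : ℤ) • J k (V 0 0 1) := by
    rw [← map_smul, ← map_smul, ← map_smul, ← map_add, ← sub_eq_zero, ← map_sub,
      ← rV (k := k) 1 1 0]
    congr 1
    ext j <;> simp [V, Y] <;> ring
  have i3 : (-16 : ℤ) • J k (V 0 (-1) (-2)) + (-8 : ℤ) • J k (V 1 0 (-4)) = 0 := by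
    rw [← map_smul, ← map_smul, ← map_add, ← rV (k := k) (-2) 1 1]
    congr 1
    ext j <;> simp [V, Y] <;> ring
  rw [map_smul] at e1 e2 e3
  have hW : J k W = J k X1 * ((2 : ℤ) • ((16 : ℤ) • J k X2) + (64 : ℤ) • J k X3)
      + J k X2 * ((-8 : ℤ) • ((4 : ℤ) • J k X1) + (2 : ℤ) • ((64 : ℤ) • J k X3))
      + J k X3 * ((-16 : ℤ) • ((4 : ℤ) • J k X1) + (-8 : ℤ) • ((16 : ℤ) • J k X2)) := by
    unfold W
    rw [map_add, map_add, map_smul, map_smul, map_smul, J_lie, J_lie, J_lie]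
    simp only [smul_smul, mul_add, mul_smul_comm, smul_sub]
    module
  rw [hW, e1, e2, e3, i1, i2, i3, mul_zero, add_zero, mul_smul_comm, mul_smul_comm,
    ← smul_mul_assoc, ← smul_mul_assoc, e1, e2]

theorem W_mem_dim (n : ℕ) (hn : 2 ≤ n) :
    (LieSubmodule.Quotient.mk W : Q n) ∈ dimensionSubring (Q n) (n + 2) := by
  apply mem_dim_of
  rw [← J_apply]
  obtain ⟨m, rfl⟩ : ∃ m, n = m + 1 := ⟨n - 1, by omega⟩
  rw [J_W]
  refine Submodule.add_mem _ (augPow_mul (m := m + 1) (n := 2) two_ne_zero ?_ ?_)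
    (augPow_mul (m := m + 1) (n := 2) two_ne_zero ?_ ?_)
  · exact J_V _ _ _ m (by omega)
  · exact J_V _ _ _ 1 (by omega)
  · exact J_V _ _ _ m (by omega)
  · exact J_V _ _ _ 1 (by omega)

theorem W_not_gamma (hk : 0 < k) :
    (LieSubmodule.Quotient.mk W : Q k) ∉ gammaLie (Q k) (k + 2) := by
  intro h
  let F : LRing k →ₗ⁅ℤ⁆ Q k :=
    { (LieSubmodule.Quotient.mk' (I k)).toLinearMap with
      map_lie' := fun {a b} => LieSubmodule.Quotient.mk_bracket _ a b }
  have hs : Function.Surjective F := LieSubmodule.Quotient.surjective_mk' (I k)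
  change _ ∈ LieModule.lowerCentralSeries ℤ (Q k) (Q k) (k + 1) at h
  have : LieModule.lowerCentralSeries ℤ (Q k) (Q k) (k + 1) = ⊥ := by
    rw [← LieIdeal.lowerCentralSeries_map_eq (k + 1) hs, lcs_top]
    exact LieIdeal.map_eq_bot_iff.2 bot_le
  rw [this, LieSubmodule.mem_bot] at h
  exact W_not_mem hk ((LieSubmodule.Quotient.mk_eq_zero' (N := I k)).1 h)

end LRing

/-- For every `n ≥ 4` there exist a Lie ring `A` and `a ∈ A` with `a ∈ δ_n(A)`,
`a ∉ γ_n(A)` and `2·a ∈ γ_n(A)`: the dimension quotient `δ_n(A)/γ_n(A)` contains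
an element of order `2`. -/
theorem lie_dimension_quotient_contains_two_torsion (n : ℕ) (hn : 4 ≤ n) :
    ∃ (A : Type) (_ : LieRing A) (_ : LieAlgebra ℤ A) (a : A),
      a ∈ dimensionSubring A n ∧ a ∉ gammaLie A n ∧ (2 : ℤ) • a ∈ gammaLie A n := by
  obtain ⟨k, rfl⟩ : ∃ k, n = k + 2 := ⟨n - 2, by omega⟩
  refine ⟨LRing.Q k, inferInstance, inferInstance, LieSubmodule.Quotient.mk LRing.W,
    LRing.W_mem_dim k (by omega), LRing.W_not_gamma (by omega), ?_⟩
  have h : (2 : ℤ) • (LieSubmodule.Quotient.mk LRing.W : LRing.Q k) = 0 := by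
    change LieSubmodule.Quotient.mk' (LRing.I k) ((2 : ℤ) • LRing.W) = 0
    rw [LRing.two_W, map_zero]
  rw [h]
  exact zero_mem _
end
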